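/- arXiv:1405.2175 — 6 statements merged into one kernel-verified Lean document; each statement's English description precedes it below -/
import Mathlib

section
/- Let s and t be coprime positive integers, m = ⌊s/2⌋, n = ⌊t/2⌋, and A_{i,j} = st − (2j−1)s − (2i−1)t for 1 ≤ i ≤ m, 1 ≤ j ≤ n. For a partition ν fitting in the m×n box, define M(ν) = { A_{i,j} : 1 ≤ i ≤ m, ν_i < j ≤ n, A_{i,j} > 0 } ∪ { −A_{i,j} : 1 ≤ i ≤ m, 1 ≤ j ≤ ν_i, A_{i,j} < 0 }. Then the map ν ↦ M(ν) sets up a bijection between partitions fitting in the m×n box and self-conjugate (s,t)-core partitions: for every such ν there is a unique self-conjugate (s,t)-core λ with MD(λ) = M(ν), and every self-conjugate (s,t)-core arises in this way from exactly one ν. -/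
/-- A partition, given by its (0-indexed) weakly decreasing sequence of parts,
which is eventually zero. Row `i` of the Young diagram has `parts i` cells;
the diagram consists of the (0-indexed) cells `(i, j)` with `j < parts i`. -/
structure YPartition where
  parts : ℕ → ℕ
  antitone : ∀ ⦃i j : ℕ⦄, i ≤ j → parts j ≤ parts i
  finite_support : ∃ N, ∀ i, N ≤ i → parts i = 0

namespace YPartition

/-- The `j`-th (0-indexed) part of the conjugate partition: the number of rows
whose length exceeds `j`. -/
noncomputable def conj (p : YPartition) (j : ℕ) : ℕ := Set.ncard {i : ℕ | j < p.parts i}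

/-- The set of (0-indexed) cells of the Young diagram. -/
def cells (p : YPartition) : Set (ℕ × ℕ) := {c | c.2 < p.parts c.1}

/-- The size of a partition: the number of cells of its Young diagram. -/
noncomputable def size (p : YPartition) : ℕ := p.cells.ncard

/-- The hook length of the (0-indexed) cell `(i, j)`:
`λ_i − j + λ'_j − i + 1` in 1-indexed terms. -/
noncomputable def hook (p : YPartition) (i j : ℕ) : ℕ := p.parts i + p.conj j - i - j - 1

/-- A partition is self-conjugate if it equals its conjugate. -/
def SelfConj (p : YPartition) : Prop := ∀ j, p.conj j = p.parts j

/-- A partition is a `t`-core if no cell of its diagram has hook length `t`. -/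
def IsCore (t : ℕ) (p : YPartition) : Prop :=
  ∀ i j : ℕ, (i, j) ∈ p.cells → p.hook i j ≠ t

/-- The set of hook lengths of the main diagonal cells. -/
def MD (p : YPartition) : Set ℕ := {h | ∃ i : ℕ, i < p.parts i ∧ h = p.hook i i}

end YPartition

/-- The Ford–Mai–Sze array entry `A_{i,j} = st − (2j−1)s − (2i−1)t` (1-indexed). -/
def fmsA (s t i j : ℕ) : ℤ :=
  (s : ℤ) * t - (2 * (j : ℤ) - 1) * s - (2 * (i : ℤ) - 1) * t

/-- Partitions fitting in the `m × n` box: at most `m` parts, each of size at most `n`. -/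
def boxSet (m n : ℕ) : Set YPartition := {ν | ν.parts 0 ≤ n ∧ ν.parts m = 0}

/-- The Ford–Mai–Sze set `M(ν)` attached to a partition `ν` in the
`⌊s/2⌋ × ⌊t/2⌋` box: the positive entries `A_{i,j}` with `ν_i < j ≤ n`, together
with the absolute values of the negative entries `A_{i,j}` with `j ≤ ν_i`
(1-indexed `i, j`; the `i`-th part of `ν` is `ν.parts (i-1)`). -/
def fmsM (s t m n : ℕ) (ν : YPartition) : Set ℕ :=
  {h | ∃ i j : ℕ, 1 ≤ i ∧ i ≤ m ∧ 1 ≤ j ∧ j ≤ n ∧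
    ((ν.parts (i - 1) < j ∧ 0 < fmsA s t i j ∧ (h : ℤ) = fmsA s t i j) ∨
     (j ≤ ν.parts (i - 1) ∧ fmsA s t i j < 0 ∧ (h : ℤ) = -fmsA s t i j))}

namespace FMS

open YPartition

/-- The array entry with integer indices. -/
def A (s t i j : ℤ) : ℤ := s * t - (2 * j - 1) * s - (2 * i - 1) * t

/-- Symmetric doubly-closed Maya sets of odd integers. -/
structure Good (s t : ℕ) (B : Set ℤ) : Prop where
  odd : ∀ x ∈ B, Odd x
  sym : ∀ x, Odd x → (x ∈ B ↔ -x ∉ B)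
  cs : ∀ x ∈ B, x - 2 * s ∈ B
  ct : ∀ x ∈ B, x - 2 * t ∈ B
  bdd : ∃ K : ℕ, ∀ x ∈ B, x < 2 * K

/-- The Maya set of a partition. -/
def beta (l : YPartition) : Set ℤ := {x | ∃ r : ℕ, x = 2 * ((l.parts r : ℤ) - r) - 1}

lemma ypart_ext {l l' : YPartition} (h : ∀ r, l.parts r = l'.parts r) : l = l' := by
  cases l; cases l'; congr; funext r; exact h r

lemma lt_conj (l : YPartition) (i j : ℕ) : i < l.conj j ↔ j < l.parts i := by
  classical
  obtain ⟨N, hN⟩ := l.finite_support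
  have hex : ∃ r, l.parts r ≤ j := ⟨N, by rw [hN N le_rfl]; omega⟩
  have hset : {i : ℕ | j < l.parts i} = ↑(Finset.range (Nat.find hex)) := by
    ext r
    simp only [Set.mem_ofPred_eq, Finset.coe_range, Set.mem_Iio]
    constructor
    · intro h
      by_contra hc
      have h1 := Nat.find_spec hex
      have h2 := l.antitone (not_lt.mp hc)
      omega
    · intro h
      have := Nat.find_min hex h
      omega
  have hc : l.conj j = Nat.find hex := by
    unfold YPartition.conj
    rw [hset, Set.ncard_coe_finset, Finset.card_range]
  have : i ∈ {i : ℕ | j < l.parts i} ↔ i < Nat.find hex := by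
    rw [hset]; simp
  rw [hc, ← this]; rfl

lemma conj_antitone (l : YPartition) {i j : ℕ} (h : i ≤ j) : l.conj j ≤ l.conj i := by
  by_contra hc
  have h1 := (lt_conj l (l.conj i) j).mp (by omega)
  have h2 := (lt_conj l (l.conj i) i).mpr (by omega)
  omega

lemma beta_not_both (l : YPartition) (r q : ℕ) :
    (l.parts r : ℤ) - r ≠ q - l.conj q + 1 := by
  have := lt_conj l r q
  by_cases h : q < l.parts r
  · have := this.mpr h; omega
  · have : ¬ r < l.conj q := fun h' => h (this.mp h'); omega

lemma beta_one (l : YPartition) (k : ℤ) :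
    (∃ r : ℕ, k = (l.parts r : ℤ) - r) ∨ (∃ q : ℕ, k = q - l.conj q + 1) := by
  classical
  obtain ⟨N, hN⟩ := l.finite_support
  have hex : ∃ r : ℕ, (l.parts r : ℤ) - r ≤ k := by
    refine ⟨N + k.natAbs, ?_⟩
    rw [hN _ (by omega)]; have := neg_abs_le k; push_cast; omega
  obtain ⟨r, hr, hmin⟩ : ∃ r : ℕ, (l.parts r : ℤ) - r ≤ k ∧
      ∀ r' < r, ¬ ((l.parts r' : ℤ) - r' ≤ k) :=
    ⟨Nat.find hex, Nat.find_spec hex, fun r' h => Nat.find_min hex h⟩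
  by_cases he : (l.parts r : ℤ) - r = k
  · exact Or.inl ⟨r, he.symm⟩
  right
  refine ⟨(k + r - 1).toNat, ?_⟩
  obtain ⟨q, hq⟩ : ∃ q : ℕ, (q : ℤ) = k + r - 1 := ⟨(k + r - 1).toNat, by omega⟩
  have hq' : (k + r - 1).toNat = q := by omega
  rw [hq']
  have h1 : ¬ r < l.conj q := by rw [lt_conj]; omega
  have h2 : r ≤ l.conj q := by
    by_contra hc
    have h3 := hmin (r - 1) (by omega)
    have h4 := (lt_conj l (r-1) q).mpr (by omega)
    omega
  omega

lemma mem_beta_odd {l : YPartition} {x : ℤ} (h : x ∈ beta l) : Odd x := by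
  obtain ⟨r, hr⟩ := h
  rw [Int.odd_iff]; omega

lemma not_mem_beta {l : YPartition} {x : ℤ} (hx : Odd x) :
    x ∉ beta l ↔ ∃ q : ℕ, x = 2 * ((q : ℤ) - l.conj q) + 1 := by
  rw [Int.odd_iff] at hx
  constructor
  · intro h
    rcases beta_one l ((x + 1) / 2) with ⟨r, hr⟩ | ⟨q, hq⟩
    · exact absurd ⟨r, by omega⟩ h
    · exact ⟨q, by omega⟩
  · rintro ⟨q, hq⟩ ⟨r, hr⟩
    exact beta_not_both l r q (by omega)

lemma core_iff (l : YPartition) (t : ℕ) (ht : 0 < t) :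
    IsCore t l ↔ ∀ x ∈ beta l, x - 2 * t ∈ beta l := by
  constructor
  · rintro h x ⟨i, hi⟩
    by_contra hc
    have hx : Odd (x - 2 * (t : ℤ)) := by rw [Int.odd_iff]; omega
    obtain ⟨j, hj⟩ := (not_mem_beta hx).mp hc
    have hij := lt_conj l i j
    by_cases hlt : j < l.parts i
    · have h3 := hij.mpr hlt
      refine h i j hlt ?_
      unfold YPartition.hook
      omega
    · have : ¬ i < l.conj j := fun h' => hlt (hij.mp h')
      omega
  · intro h i j hc hk
    have hlt : j < l.parts i := hc
    have h3 := (lt_conj l i j).mpr hlt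
    unfold YPartition.hook at hk
    have h4 := h _ ⟨i, rfl⟩
    exact (not_mem_beta (mem_beta_odd h4)).mpr ⟨j, by omega⟩ h4

lemma beta_sym {l : YPartition} (hl : l.SelfConj) (x : ℤ) (hx : Odd x) :
    x ∈ beta l ↔ -x ∉ beta l := by
  rw [not_mem_beta hx.neg]
  constructor
  · rintro ⟨r, hr⟩
    exact ⟨r, by rw [hl r]; omega⟩
  · rintro ⟨r, hr⟩
    rw [hl r] at hr
    exact ⟨r, by omega⟩

lemma strictMono_parts (f : ℕ → ℕ) (hf : ∀ i j, i ≤ j → f j ≤ f i) :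
    StrictMono (fun r : ℕ => (r : ℤ) - f r) := by
  intro a b h
  have := hf a b h.le
  show (a : ℤ) - f a < b - f b
  omega

lemma selfConj_of_sym {l : YPartition}
    (h : ∀ x, Odd x → (x ∈ beta l ↔ -x ∉ beta l)) : l.SelfConj := by
  have h1 := strictMono_parts l.parts (fun i j h => l.antitone h)
  have h2 := strictMono_parts l.conj (fun i j h => conj_antitone l h)
  have h3 : Set.range (fun r : ℕ => (r : ℤ) - l.parts r) =
      Set.range (fun r : ℕ => (r : ℤ) - l.conj r) := by
    ext y
    have ho : Odd (-2 * y - 1) := by rw [Int.odd_iff]; omega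
    have h4 := h _ ho
    rw [not_mem_beta ho.neg] at h4
    constructor
    · rintro ⟨r, hr⟩
      simp only at hr
      obtain ⟨q, hq⟩ := h4.mp ⟨r, by omega⟩
      exact ⟨q, by simp only; omega⟩
    · rintro ⟨r, hr⟩
      simp only at hr
      obtain ⟨q, hq⟩ := h4.mpr ⟨r, by omega⟩
      exact ⟨q, by simp only; omega⟩
  have h5 := (StrictMono.range_inj h1 h2).mp h3
  intro j
  have : (j : ℤ) - _ = j - _ := congrFun h5 j
  omega

lemma beta_inj {l l' : YPartition} (h : beta l = beta l') : l = l' := by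
  have h1 := strictMono_parts l.parts (fun i j h => l.antitone h)
  have h2 := strictMono_parts l'.parts (fun i j h => l'.antitone h)
  have h3 : Set.range (fun r : ℕ => (r : ℤ) - l.parts r) =
      Set.range (fun r : ℕ => (r : ℤ) - l'.parts r) := by
    ext y
    have h4 : -2 * y - 1 ∈ beta l ↔ -2 * y - 1 ∈ beta l' := by rw [h]
    constructor
    · rintro ⟨r, hr⟩
      simp only at hr
      obtain ⟨q, hq⟩ := h4.mp ⟨r, by omega⟩
      exact ⟨q, by simp only; omega⟩
    · rintro ⟨r, hr⟩
      simp only at hr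
      obtain ⟨q, hq⟩ := h4.mpr ⟨r, by omega⟩
      exact ⟨q, by simp only; omega⟩
  have h5 := (StrictMono.range_inj h1 h2).mp h3
  apply ypart_ext
  intro j
  have : (j : ℤ) - _ = j - _ := congrFun h5 j
  omega

lemma mem_MD {l : YPartition} (hl : l.SelfConj) (h : ℕ) :
    h ∈ l.MD ↔ (0 < h ∧ (h : ℤ) ∈ beta l) := by
  constructor
  · rintro ⟨i, hi, rfl⟩
    unfold YPartition.hook
    rw [hl i]
    exact ⟨by omega, i, by omega⟩
  · rintro ⟨h0, i, hi⟩
    refine ⟨i, by omega, ?_⟩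
    unfold YPartition.hook
    rw [hl i]
    omega

lemma good_beta {s t : ℕ} (hs : 0 < s) (ht : 0 < t) {l : YPartition} (hl : l.SelfConj)
    (h1 : IsCore s l) (h2 : IsCore t l) : Good s t (beta l) where
  odd := fun x hx => mem_beta_odd hx
  sym := beta_sym hl
  cs := (core_iff l s hs).mp h1
  ct := (core_iff l t ht).mp h2
  bdd := by
    refine ⟨l.parts 0, ?_⟩
    rintro x ⟨r, hr⟩
    have := l.antitone (Nat.zero_le r)
    omega

lemma good_ext {s t : ℕ} {B B' : Set ℤ} (h : Good s t B) (h' : Good s t B')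
    (hp : ∀ x : ℕ, 0 < x → ((x : ℤ) ∈ B ↔ (x : ℤ) ∈ B')) : B = B' := by
  ext x
  by_cases hx : Odd x
  · rcases lt_trichotomy x 0 with h0 | h0 | h0
    · have := hp (-x).toNat (by omega)
      rw [show ((-x).toNat : ℤ) = -x by omega] at this
      rw [h.sym x hx, h'.sym x hx, this]
    · subst h0; simp at hx
    · have := hp x.toNat (by omega)
      rwa [show (x.toNat : ℤ) = x by omega] at this
  · exact ⟨fun h1 => absurd (h.odd x h1) hx, fun h1 => absurd (h'.odd x h1) hx⟩

lemma exists_beta {s t : ℕ} {B : Set ℤ} (h : Good s t B) : ∃ l : YPartition, beta l = B := by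
  classical
  obtain ⟨K, hK⟩ := h.bdd
  obtain ⟨P, hP⟩ : ∃ P : ℕ → Prop, ∀ n, P n ↔ (2 * (K : ℤ) - 1 - 2 * n) ∈ B :=
    ⟨_, fun n => Iff.rfl⟩
  have hsymP : ∀ n, n < 2 * K → (P (2 * K - 1 - n) ↔ ¬ P n) := by
    intro n hn
    rw [hP, hP, h.sym _ (by rw [Int.odd_iff]; omega)]
    have : -(2 * (K : ℤ) - 1 - 2 * ((2 * K - 1 - n : ℕ) : ℤ)) = 2 * (K : ℤ) - 1 - 2 * n := by
      omega
    rw [this]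
  have hbig : ∀ n, 2 * K ≤ n → P n := by
    intro n hn
    rw [hP, h.sym _ (by rw [Int.odd_iff]; omega)]
    intro hc
    have := hK _ hc
    omega
  have hcount : Nat.count P (2 * K) = K := by
    rw [Nat.count_eq_card_filter_range]
    have h1 := Finset.card_filter_add_card_filter_not (s := Finset.range (2 * K)) P
    have h2 : (Finset.filter (fun n => ¬ P n) (Finset.range (2 * K))).card =
        (Finset.filter P (Finset.range (2 * K))).card := by
      refine Finset.card_bij' (fun n _ => 2 * K - 1 - n) (fun n _ => 2 * K - 1 - n) ?_ ?_ ?_ ?_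
      · intro n hn
        simp only [Finset.mem_filter, Finset.mem_range] at hn ⊢
        exact ⟨by omega, (hsymP n hn.1).mpr hn.2⟩
      · intro n hn
        simp only [Finset.mem_filter, Finset.mem_range] at hn ⊢
        exact ⟨by omega, fun hc => (hsymP n hn.1).mp hc hn.2⟩
      · intro n hn
        simp only [Finset.mem_filter, Finset.mem_range] at hn
        omega
      · intro n hn
        simp only [Finset.mem_filter, Finset.mem_range] at hn
        omega
    rw [Finset.card_range] at h1
    have h3 : (Finset.filter P (Finset.range (2 * K))).card +
        (Finset.filter (fun n => ¬ P n) (Finset.range (2 * K))).card = 2 * K := by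
      convert h1
    rw [h2, ← two_mul] at h3
    exact Nat.eq_of_mul_eq_mul_left two_pos h3
  have hcount' : ∀ a, Nat.count P (2 * K + a) = K + a := by
    intro a
    induction a with
    | zero => simpa using hcount
    | succ a ih =>
      rw [← add_assoc, Nat.count_succ, ih, if_pos (hbig _ (by omega))]
      omega
  have hnth : ∀ a, Nat.nth P (K + a) = 2 * K + a := by
    intro a
    have := Nat.nth_count (hbig (2 * K + a) (by omega))
    rwa [hcount'] at this
  have hinf : (Set.ofPred P).Infinite := by
    refine Set.infinite_of_injective_forall_mem (f := fun a : ℕ => 2 * K + a) ?_ ?_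
    · intro a b hab
      simpa using hab
    · intro a
      exact hbig _ (by omega)
  have hmono := Nat.nth_strictMono hinf
  have hle : ∀ r, Nat.nth P r ≤ K + r := by
    intro r
    have h1 := hmono.add_le_nat K r
    rw [hnth] at h1
    omega
  refine ⟨⟨fun r => K + r - Nat.nth P r, ?_, ⟨K, ?_⟩⟩, ?_⟩
  · intro i j hij
    have h1 := hmono.add_le_nat (j - i) i
    rw [Nat.sub_add_cancel hij] at h1
    omega
  · intro i hi
    have h1 := hnth (i - K)
    rw [Nat.add_sub_cancel' hi] at h1
    omega
  · ext x
    constructor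
    · rintro ⟨r, hr⟩
      simp only at hr
      have h1 := (hP _).mp (Nat.nth_mem_of_infinite hinf r)
      have h2 := hle r
      convert h1 using 1
      omega
    · intro hx
      have h1 := h.odd x hx
      rw [Int.odd_iff] at h1
      have h2 := hK x hx
      obtain ⟨n, hn⟩ : ∃ n : ℕ, x = 2 * (K : ℤ) - 1 - 2 * n :=
        ⟨((2 * (K : ℤ) - 1 - x) / 2).toNat, by omega⟩
      have hPn : P n := by rw [hP, ← hn]; exact hx
      refine ⟨Nat.count P n, ?_⟩
      have h3 := Nat.nth_count hPn
      have h4 := hle (Nat.count P n)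
      rw [h3] at h4
      simp only [h3]
      omega

lemma Good.cs_many {s t : ℕ} {B : Set ℤ} (h : Good s t B) {x : ℤ} (hx : x ∈ B) (k : ℕ) :
    x - 2 * s * k ∈ B := by
  induction k with
  | zero => simpa using hx
  | succ k ih =>
    have := h.cs _ ih
    convert this using 1
    push_cast; ring

lemma A_odd {s t : ℕ} (hst : Nat.Coprime s t) (i j : ℤ) : Odd (A s t i j) := by
  have h : ¬ (2 ∣ s ∧ 2 ∣ t) := by
    rintro ⟨h1, h2⟩
    have := Nat.dvd_gcd h1 h2
    rw [hst] at this
    omega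
  have h2 : (s % 2 = 1 ∨ t % 2 = 1) := by omega
  have h3 : Even (((s : ℤ) + 1) * (t + 1)) := by
    rw [Int.even_mul]
    rcases h2 with h2 | h2
    · left; rw [Int.even_iff]; omega
    · right; rw [Int.even_iff]; omega
  obtain ⟨a, ha⟩ := h3
  refine ⟨a - j * s - i * t - 1, ?_⟩
  unfold A
  linear_combination ha

lemma A_rep {s t : ℕ} (hs : 0 < s) (hst : Nat.Coprime s t) {x : ℤ} (hx : Odd x) :
    ∃ i j : ℤ, 1 ≤ i ∧ i ≤ s ∧ A s t i j = x := by
  have h0 : IsCoprime (s : ℤ) t := Nat.isCoprime_iff_coprime.mpr hst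
  obtain ⟨u, v, huv⟩ := h0
  obtain ⟨a, ha⟩ := A_odd hst 0 0
  obtain ⟨b, hb⟩ := hx
  have hsz : (0 : ℤ) < s := by omega
  have h1 := Int.emod_nonneg (v * (a - b) - 1) hsz.ne'
  have h2 := Int.emod_lt_of_pos (v * (a - b) - 1) hsz
  have h3 := Int.emod_add_mul_ediv (v * (a - b) - 1) s
  refine ⟨(v * (a - b) - 1) % s + 1, u * (a - b) + t * ((v * (a - b) - 1) / s),
    by omega, by omega, ?_⟩
  unfold A at ha ⊢
  linear_combination ha - hb - 2 * t * h3 - 2 * (a - b) * huv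

lemma A_uniq {s t : ℕ} (hs : 0 < s) (hst : Nat.Coprime s t) {i j i' j' : ℤ}
    (h : A s t i j = A s t i' j') : ∃ k : ℤ, i' = i + k * s ∧ j' = j - k * t := by
  have h0 : IsCoprime (s : ℤ) t := Nat.isCoprime_iff_coprime.mpr hst
  have h1 : (s : ℤ) * (j - j') = t * (i' - i) := by
    unfold A at h
    linarith
  have h2 : (s : ℤ) ∣ i' - i := h0.dvd_of_dvd_mul_left ⟨_, h1.symm⟩
  obtain ⟨k, hk⟩ := h2
  refine ⟨k, by linarith, ?_⟩
  have hsz : (s : ℤ) ≠ 0 := by omega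
  apply mul_left_cancel₀ hsz
  rw [hk] at h1
  linarith

lemma A_neg (s t i j : ℤ) : -A s t i j = A s t (s + 1 - i) (1 - j) := by unfold A; ring

lemma A_neg' (s t i j : ℤ) : -A s t i j = A s t (1 - i) (t + 1 - j) := by unfold A; ring

/-- The partition `ν` records the row thresholds of `B`. -/
def Rel (s t : ℕ) (B : Set ℤ) (ν : YPartition) : Prop :=
  ∀ r : ℕ, r < s / 2 → ∀ j : ℤ, A s t (r + 1) j ∈ B ↔ (ν.parts r : ℤ) < j

lemma exists_threshold {s t : ℕ} (hs : 0 < s) (hst : Nat.Coprime s t) {B : Set ℤ}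
    (h : Good s t B) (i : ℤ) : ∃ c : ℤ, ∀ j, A s t i j ∈ B ↔ c < j := by
  obtain ⟨K, hK⟩ := h.bdd
  obtain ⟨C, hC⟩ : ∃ C : ℤ, ∀ j, A s t i j = C - 2 * (j * s) :=
    ⟨s * t + s - (2 * i - 1) * t, fun j => by unfold A; ring⟩
  have hsz : (1 : ℤ) ≤ s := by omega
  have hup : ∀ j, |C| + K ≤ j → A s t i j ∈ B := by
    intro j hj
    rw [h.sym _ (A_odd hst i j)]
    intro hc
    have h1 := hK _ hc
    rw [hC] at h1
    have h2 := le_abs_self C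
    have h3 := abs_nonneg C
    have h4 : j ≤ j * s := le_mul_of_one_le_right (by omega) hsz
    omega
  have hdown : ∀ j, j ≤ -(|C| + K) → A s t i j ∉ B := by
    intro j hj hc
    have h1 := hK _ hc
    rw [hC] at h1
    have h2 := neg_abs_le C
    have h3 := abs_nonneg C
    have h4 : -j ≤ -j * s := le_mul_of_one_le_right (by omega) hsz
    have h5 : -j * (s : ℤ) = -(j * s) := by ring
    omega
  obtain ⟨c, hc1, hc2⟩ := Int.exists_greatest_of_bdd (P := fun j => A s t i j ∉ B)
    ⟨|C| + K, fun z hz => by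
      by_contra hlt
      exact hz (hup z (by omega))⟩ ⟨_, hdown _ le_rfl⟩
  refine ⟨c, fun j => ?_⟩
  constructor
  · intro hj
    by_contra hcj
    apply hc1
    have h1 := h.cs_many hj (c - j).toNat
    convert h1 using 1
    rw [Int.toNat_of_nonneg (by omega), hC, hC]
    ring
  · intro hj
    by_contra hcj
    have := hc2 j hcj
    omega

lemma exists_nu {s t : ℕ} (hs : 0 < s) (hst : Nat.Coprime s t) {B : Set ℤ}
    (h : Good s t B) : ∃ ν ∈ boxSet (s / 2) (t / 2), Rel s t B ν := by
  choose c hc using exists_threshold hs hst h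
  have hanti : Antitone c := by
    apply antitone_int_of_succ_le
    intro i
    by_contra hlt
    have h1 := (hc i (c (i + 1))).mpr (by omega)
    have h2 := h.ct _ h1
    have h3 : A s t i (c (i + 1)) - 2 * t = A s t (i + 1) (c (i + 1)) := by unfold A; ring
    rw [h3, hc] at h2
    omega
  have hneg : ∀ i, c i + c (s + 1 - i) = 0 := by
    intro i
    have h1 : ∀ j, c i < j ↔ ¬ (c (s + 1 - i) < 1 - j) := by
      intro j
      rw [← hc, ← hc, ← A_neg, h.sym _ (A_odd hst i j)]
    have h2 := h1 (c i)
    have h3 := h1 (c i + 1)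
    omega
  have hneg' : ∀ i, c i + c (1 - i) = t := by
    intro i
    have h1 : ∀ j, c i < j ↔ ¬ (c (1 - i) < t + 1 - j) := by
      intro j
      rw [← hc, ← hc, ← A_neg', h.sym _ (A_odd hst i j)]
    have h2 := h1 (c i)
    have h3 := h1 (c i + 1)
    omega
  have hc1 : c 1 ≤ (t / 2 : ℕ) := by
    have h1 := hneg' 1
    have h2 := hanti (show (1 - 1 : ℤ) ≤ 1 by omega)
    omega
  have hc0 : ∀ r : ℕ, r < s / 2 → 0 ≤ c (r + 1) := by
    intro r hr
    have h1 := hneg (r + 1)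
    have h2 := hanti (show (r + 1 : ℤ) ≤ s + 1 - (r + 1) by omega)
    omega
  refine ⟨⟨fun r => if r < s / 2 then (c (r + 1)).toNat else 0, ?_, ⟨s / 2, ?_⟩⟩, ⟨?_, ?_⟩, ?_⟩
  · intro i j hij
    have h1 := hanti (show (i + 1 : ℤ) ≤ j + 1 by omega)
    try dsimp only
    split_ifs <;> omega
  · intro i hi
    exact if_neg (by omega)
  · try dsimp only
    split_ifs
    · simp only [Nat.cast_zero, zero_add]; omega
    · omega
  · exact if_neg (by omega)
  · intro r hr j
    rw [hc]
    try dsimp only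
    rw [if_pos hr]
    have := hc0 r hr
    omega

lemma pos_eq_fmsM {s t : ℕ} (hs : 0 < s) (ht : 0 < t) (hst : Nat.Coprime s t) {B : Set ℤ}
    (h : Good s t B) {ν : YPartition} (hν : ν ∈ boxSet (s / 2) (t / 2)) (hR : Rel s t B ν)
    (x : ℕ) : (0 < x ∧ (x : ℤ) ∈ B) ↔ x ∈ fmsM s t (s / 2) (t / 2) ν := by
  have hfA : ∀ i j : ℕ, fmsA s t i j = A s t i j := fun i j => rfl
  have hsz : (1 : ℤ) ≤ s := by omega
  have htz : (1 : ℤ) ≤ t := by omega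
  have hR' : ∀ i : ℕ, 1 ≤ i → i ≤ s / 2 → ∀ j : ℤ,
      A s t i j ∈ B ↔ (ν.parts (i - 1) : ℤ) < j := by
    intro i h1 h2 j
    have := hR (i - 1) (by omega) j
    rwa [show ((i - 1 : ℕ) : ℤ) + 1 = i by omega] at this
  constructor
  · rintro ⟨hx0, hxB⟩
    obtain ⟨i, j, hi1, his, hA⟩ := A_rep hs hst (h.odd _ hxB)
    by_cases him : i ≤ (s / 2 : ℕ)
    · obtain ⟨i, rfl⟩ := Int.eq_ofNat_of_zero_le (show 0 ≤ i by omega)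
      have h1 := (hR' i (by omega) (by omega) j).mp (by rw [hA]; exact hxB)
      obtain ⟨j, rfl⟩ := Int.eq_ofNat_of_zero_le (show 0 ≤ j by omega)
      refine ⟨i, j, by omega, by omega, by omega, ?_, Or.inl ⟨by omega, ?_, ?_⟩⟩
      · by_contra hjn
        have h2 : (t : ℤ) ≤ 2 * j - 1 := by omega
        have h3 : (s : ℤ) * t ≤ (2 * (j : ℤ) - 1) * s := by nlinarith
        have h4 : (0 : ℤ) ≤ (2 * (i : ℤ) - 1) * t := mul_nonneg (by omega) (by omega)
        unfold A at hA
        omega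
      · rw [hfA, hA]; omega
      · rw [hfA, hA]
    · have hnx : -(x : ℤ) ∉ B := (h.sym _ (h.odd _ hxB)).mp hxB
      have hA' : A s t (s + 1 - i) (1 - j) = -(x : ℤ) := by rw [← A_neg, hA]
      by_cases him' : s + 1 - i ≤ (s / 2 : ℕ)
      · obtain ⟨i', hi'⟩ := Int.eq_ofNat_of_zero_le (show 0 ≤ s + 1 - i by omega)
        rw [hi'] at hA'
        have hj1 : 1 ≤ 1 - j := by
          by_contra hj
          have h2 : (2 * (1 - j) - 1) * (s : ℤ) ≤ 0 :=
            mul_nonpos_of_nonpos_of_nonneg (by omega) (by omega)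
          have h3 : (2 * (i' : ℤ) - 1) * t ≤ s * t :=
            mul_le_mul_of_nonneg_right (by omega) (by omega)
          unfold A at hA'
          omega
        obtain ⟨j', hj'⟩ := Int.eq_ofNat_of_zero_le (show 0 ≤ 1 - j by omega)
        rw [hj'] at hA'
        have h1 : ¬ ((ν.parts (i' - 1) : ℤ) < j') := by
          rw [← hR' i' (by omega) (by omega) j', hA']
          exact hnx
        have h2 := ν.antitone (Nat.zero_le (i' - 1))
        have h3 := hν.1
        refine ⟨i', j', by omega, by omega, by omega, by omega, Or.inr ⟨by omega, ?_, ?_⟩⟩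
        · rw [hfA, hA']; omega
        · rw [hfA, hA']; omega
      · exfalso
        have hi2 : 2 * i - 1 = s := by omega
        have hx' : (x : ℤ) = -(2 * j - 1) * s := by
          rw [← hA]; unfold A; rw [hi2]; ring
        have hj0 : j ≤ 0 := by
          by_contra hj
          have : 0 ≤ (2 * j - 1) * (s : ℤ) := mul_nonneg (by omega) (by omega)
          rw [neg_mul] at hx'
          omega
        have h1 := h.cs_many hxB (1 - 2 * j).toNat
        rw [Int.toNat_of_nonneg (by omega)] at h1
        apply hnx
        convert h1 using 1
        linear_combination (-2) * hx'
  · rintro ⟨i, j, hi1, hi2, hj1, hj2, ⟨h1, h2, h3⟩ | ⟨h1, h2, h3⟩⟩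
    · refine ⟨by omega, ?_⟩
      rw [h3, hfA, hR' i hi1 hi2]
      omega
    · refine ⟨by omega, ?_⟩
      rw [h3, hfA, h.sym _ (A_odd hst _ _).neg, neg_neg, hR' i hi1 hi2]
      omega

/-- Thresholds on the fundamental rows `0 ≤ a < s`. -/
def dd (s : ℕ) (ν : YPartition) (a : ℤ) : ℤ :=
  if a < (s / 2 : ℕ) then (ν.parts a.toNat : ℤ)
  else if s - 1 - a < (s / 2 : ℕ) then -(ν.parts (s - 1 - a).toNat : ℤ) else 0

/-- Thresholds on all rows. -/
def cc (s t : ℕ) (ν : YPartition) (r : ℤ) : ℤ := dd s ν (r % s) - t * (r / s)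

lemma dd_neg (s : ℕ) (ν : YPartition) (a : ℤ) :
    dd s ν (s - 1 - a) = -dd s ν a := by
  unfold dd
  rw [show (s : ℤ) - 1 - (s - 1 - a) = a by ring]
  split_ifs <;> omega

lemma dd_anti (s : ℕ) (ν : YPartition) (a : ℤ) : dd s ν (a + 1) ≤ dd s ν a := by
  have h1 := ν.antitone (show a.toNat ≤ (a + 1).toNat by omega)
  have h2 := ν.antitone (show (s - 1 - (a + 1)).toNat ≤ (s - 1 - a).toNat by omega)
  unfold dd
  split_ifs <;> omega

lemma dd_bd {s n : ℕ} {ν : YPartition} (hν : ν.parts 0 ≤ n) (a : ℤ) :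
    -(n : ℤ) ≤ dd s ν a ∧ dd s ν a ≤ n := by
  have h1 := ν.antitone (Nat.zero_le a.toNat)
  have h2 := ν.antitone (Nat.zero_le (s - 1 - a).toNat)
  unfold dd
  split_ifs <;> omega

lemma cc_eq {s : ℕ} (t : ℕ) (ν : YPartition) {a : ℤ} (q : ℤ) (h0 : 0 ≤ a)
    (h1 : a < s) : cc s t ν (a + q * s) = dd s ν a - t * q := by
  unfold cc
  rw [Int.add_mul_emod_self_right, Int.emod_eq_of_lt h0 h1, Int.add_mul_ediv_right _ _ (by omega),
    Int.ediv_eq_zero_of_lt h0 h1, zero_add]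

lemma decomp {s : ℕ} (hs : 0 < s) (r : ℤ) :
    ∃ a q : ℤ, 0 ≤ a ∧ a < s ∧ r = a + q * s := by
  have hsz : (0 : ℤ) < s := by omega
  refine ⟨r % s, r / s, Int.emod_nonneg _ hsz.ne', Int.emod_lt_of_pos _ hsz, ?_⟩
  have := Int.emod_add_mul_ediv r s
  linarith

lemma exists_good {s t : ℕ} (hs : 0 < s) (hst : Nat.Coprime s t)
    {ν : YPartition} (hν : ν ∈ boxSet (s / 2) (t / 2)) : ∃ B, Good s t B ∧ Rel s t B ν := by
  have hbd := fun a => dd_bd (s := s) hν.1 a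
  obtain ⟨c, hc⟩ : ∃ c, c = cc s t ν := ⟨_, rfl⟩
  have hper : ∀ r k : ℤ, c (r + k * s) = c r - t * k := by
    intro r k
    obtain ⟨a, q, h0, h1, rfl⟩ := decomp hs r
    rw [show a + q * s + k * s = a + (q + k) * s by ring, hc, cc_eq t ν _ h0 h1, cc_eq t ν _ h0 h1]
    ring
  have hbase : ∀ a : ℤ, 0 ≤ a → a < s → c a = dd s ν a := by
    intro a h0 h1
    have := cc_eq t ν 0 h0 h1
    rw [hc]
    simpa using this
  have hneg : ∀ r, c (-1 - r) = t - c r := by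
    intro r
    obtain ⟨a, q, h0, h1, rfl⟩ := decomp hs r
    rw [show -1 - (a + q * s) = (s - 1 - a) + (-1 - q) * s by ring, hper, hper, hbase a h0 h1,
      hbase _ (by omega) (by omega), dd_neg]
    ring
  have hanti : ∀ r, c (r + 1) ≤ c r := by
    intro r
    obtain ⟨a, q, h0, h1, rfl⟩ := decomp hs r
    by_cases h2 : a + 1 < s
    · rw [show a + q * s + 1 = (a + 1) + q * s by ring, hper, hper, hbase a h0 h1,
        hbase _ (by omega) h2]
      have := dd_anti s ν a
      omega
    · have h3 : (s : ℤ) = a + 1 := by omega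
      rw [show a + q * s + 1 = 0 + (q + 1) * s by rw [h3]; ring, hper, hper, hbase a h0 h1,
        hbase _ le_rfl (by omega)]
      have h4 := hbd 0
      have h5 := hbd a
      have h6 : (t : ℤ) * (q + 1) = t * q + t := by ring
      omega
  obtain ⟨B, hB⟩ : ∃ B : Set ℤ, ∀ x, x ∈ B ↔ ∃ i j : ℤ, x = A s t (i + 1) j ∧ c i < j :=
    ⟨{x | ∃ i j : ℤ, x = A s t (i + 1) j ∧ c i < j}, fun x => Iff.rfl⟩
  have hmem : ∀ i j : ℤ, A s t (i + 1) j ∈ B ↔ c i < j := by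
    intro i j
    rw [hB]
    constructor
    · rintro ⟨i', j', h1, h2⟩
      obtain ⟨k, hk1, hk2⟩ := A_uniq hs hst h1
      rw [show i' = i + k * s by linarith, hper, mul_comm] at h2
      omega
    · intro h
      exact ⟨i, j, rfl, h⟩
  have hrep : ∀ x, Odd x → ∃ i j : ℤ, 0 ≤ i ∧ i < s ∧ x = A s t (i + 1) j := by
    intro x hx
    obtain ⟨i, j, h1, h2, h3⟩ := A_rep hs hst hx
    exact ⟨i - 1, j, by omega, by omega, by rw [← h3]; congr 1; ring⟩
  have hodd : ∀ x ∈ B, Odd x := by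
    intro x hx
    obtain ⟨i, j, rfl, -⟩ := (hB x).mp hx
    exact A_odd hst _ _
  refine ⟨B, ⟨hodd, ?_, ?_, ?_, ⟨2 * (s * t), ?_⟩⟩, ?_⟩
  · intro x hx
    obtain ⟨i, j, -, -, rfl⟩ := hrep x hx
    rw [A_neg', show (1 : ℤ) - (i + 1) = (-1 - i) + 1 by ring, hmem, hmem, hneg]
    omega
  · intro x hx
    obtain ⟨i, j, rfl, h⟩ := (hB x).mp hx
    rw [show A s t (i + 1) j - 2 * s = A s t (i + 1) (j + 1) by unfold A; ring, hmem]
    omega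
  · intro x hx
    obtain ⟨i, j, rfl, h⟩ := (hB x).mp hx
    rw [show A s t (i + 1) j - 2 * t = A s t ((i + 1) + 1) j by unfold A; ring, hmem]
    have := hanti i
    omega
  · intro x hx
    obtain ⟨i, j, h0, h1, rfl⟩ := hrep x (hodd x hx)
    rw [hmem, hbase i h0 h1] at hx
    have h2 := hbd i
    have h3 : -(2 * (t : ℤ)) + 1 ≤ 2 * j - 1 := by omega
    have h4 : (-(2 * (t : ℤ)) + 1) * s ≤ (2 * j - 1) * s :=
      mul_le_mul_of_nonneg_right h3 (by omega)
    have h5 : 0 ≤ (2 * (i + 1) - 1) * (t : ℤ) := mul_nonneg (by omega) (by omega)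
    have h6 : 0 ≤ (s : ℤ) * t := by positivity
    have h7 : (0 : ℤ) < s := by omega
    unfold A
    push_cast
    linarith
  · intro r hr j
    rw [hmem, hbase r (by omega) (by omega)]
    unfold dd
    rw [if_pos (by omega), Int.toNat_natCast]

lemma rel_inj {s t : ℕ} {B : Set ℤ} {ν ν' : YPartition} (hν : ν ∈ boxSet (s / 2) (t / 2))
    (hν' : ν' ∈ boxSet (s / 2) (t / 2)) (h : Rel s t B ν) (h' : Rel s t B ν') : ν = ν' := by
  apply ypart_ext
  intro r
  by_cases hr : r < s / 2
  · have h1 := fun j => (h r hr j).symm.trans (h' r hr j)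
    have h2 := h1 (ν.parts r)
    have h3 := h1 (ν'.parts r)
    omega
  · have h1 := ν.antitone (not_lt.mp hr)
    have h2 := ν'.antitone (not_lt.mp hr)
    have h3 := hν.2
    have h4 := hν'.2
    omega

lemma fmsM_inj {s t : ℕ} (hs : 0 < s) (ht : 0 < t) (hst : Nat.Coprime s t)
    {ν ν' : YPartition} (hν : ν ∈ boxSet (s / 2) (t / 2)) (hν' : ν' ∈ boxSet (s / 2) (t / 2))
    (h : fmsM s t (s / 2) (t / 2) ν = fmsM s t (s / 2) (t / 2) ν') : ν = ν' := by
  obtain ⟨B, hB, hR⟩ := exists_good hs hst hν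
  obtain ⟨B', hB', hR'⟩ := exists_good hs hst hν'
  have hBB : B = B' := by
    apply good_ext hB hB'
    intro x hx
    have h1 := pos_eq_fmsM hs ht hst hB hν hR x
    have h2 := pos_eq_fmsM hs ht hst hB' hν' hR' x
    rw [h] at h1
    have h3 := h1.trans h2.symm
    simpa [hx] using h3
  subst hBB
  exact rel_inj hν hν' hR hR'

end FMS

open YPartition in
/-- (Ford–Mai–Sze) `ν ↦ M(ν)` is a bijection between partitions fitting in the
`⌊s/2⌋ × ⌊t/2⌋` box and self-conjugate `(s,t)`-core partitions: each `M(ν)` is the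
main diagonal hook length set of a unique self-conjugate `(s,t)`-core, and every
self-conjugate `(s,t)`-core arises this way from exactly one `ν`. -/
theorem fms_bijection (s t : ℕ) (hs : 0 < s) (ht : 0 < t) (hst : Nat.Coprime s t) :
    (∀ ν ∈ boxSet (s / 2) (t / 2),
      ∃! l : YPartition, (l.SelfConj ∧ IsCore s l ∧ IsCore t l) ∧
        l.MD = fmsM s t (s / 2) (t / 2) ν) ∧
    (∀ l : YPartition, l.SelfConj → IsCore s l → IsCore t l →
      ∃! ν : YPartition, ν ∈ boxSet (s / 2) (t / 2) ∧
        l.MD = fmsM s t (s / 2) (t / 2) ν) := by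
  constructor
  · intro ν hν
    obtain ⟨B, hB, hR⟩ := FMS.exists_good hs hst hν
    obtain ⟨l, rfl⟩ := FMS.exists_beta hB
    have hl : l.SelfConj := FMS.selfConj_of_sym hB.sym
    have hM : l.MD = fmsM s t (s / 2) (t / 2) ν := by
      ext x
      rw [FMS.mem_MD hl, FMS.pos_eq_fmsM hs ht hst hB hν hR]
    refine ⟨l, ⟨⟨hl, (FMS.core_iff l s hs).mpr hB.cs, (FMS.core_iff l t ht).mpr hB.ct⟩, hM⟩, ?_⟩
    rintro l' ⟨⟨h1, h2, h3⟩, h4⟩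
    apply FMS.beta_inj
    apply FMS.good_ext (FMS.good_beta hs ht h1 h2 h3) hB
    intro x hx
    have h5 := FMS.mem_MD h1 x
    have h6 := FMS.mem_MD hl x
    rw [h4, ← hM] at h5
    simpa [hx] using h5.symm.trans h6
  · intro l h1 h2 h3
    have hB := FMS.good_beta hs ht h1 h2 h3
    obtain ⟨ν, hν, hR⟩ := FMS.exists_nu hs hst hB
    have hM : l.MD = fmsM s t (s / 2) (t / 2) ν := by
      ext x
      rw [FMS.mem_MD h1, FMS.pos_eq_fmsM hs ht hst hB hν hR]
    refine ⟨ν, ⟨hν, hM⟩, ?_⟩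
    rintro ν' ⟨hν', hM'⟩
    exact FMS.fmsM_inj hs ht hst hν' hν (hM'.symm.trans hM)
end

section
/- Let s and t be coprime positive integers, m = ⌊s/2⌋, n = ⌊t/2⌋, and A_{i,j} = st − (2j−1)s − (2i−1)t for 1 ≤ i ≤ m, 1 ≤ j ≤ n. Then the sum of the positive entries of the array A equals (s²−1)(t²−1)/24, i.e., Σ_{1≤i≤m, 1≤j≤n, A_{i,j}>0} A_{i,j} = (s²−1)(t²−1)/24. -/
lemma aux_row (s u : ℤ) (hs : 0 < s) (q : ℕ) (h1 : -s ≤ u - 2 * s * q) (h2 : u - 2 * s * q ≤ s) (n : ℕ) :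
    (∑ j ∈ Finset.Icc 1 n, if 0 < u - (2 * (j : ℤ) - 1) * s then u - (2 * (j : ℤ) - 1) * s else 0) =
      (min n q : ℕ) * u - s * ((min n q : ℕ) : ℤ) ^ 2 := by
  induction n with
  | zero => simp
  | succ k ih =>
    rw [Finset.sum_Icc_succ_top (by omega), ih]
    rcases Nat.lt_or_ge k q with h | h
    · rw [min_eq_left h.le, min_eq_left (by omega : k + 1 ≤ q)]
      have hk : (k : ℤ) + 1 ≤ q := by exact_mod_cast h
      push_cast
      split_ifs with h3
      · ring
      · have : u - (2 * ((k : ℤ) + 1) - 1) * s = 0 := by nlinarith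
        linear_combination -this
    · rw [min_eq_right h, min_eq_right (by omega : q ≤ k + 1)]
      have hk : (q : ℤ) ≤ k := by exact_mod_cast h
      rw [if_neg]
      · ring
      · push_cast
        nlinarith

lemma aux_sq (s : ℤ) (m : ℕ) :
    3 * ∑ i ∈ Finset.Icc 1 m, (s - 2 * (i : ℤ) + 1) ^ 2 =
      3 * m * (s + 1) ^ 2 - 6 * (s + 1) * m * (m + 1) + 2 * m * (m + 1) * (2 * m + 1) := by
  induction m with
  | zero => simp
  | succ k ih =>
    rw [Finset.sum_Icc_succ_top (by omega), mul_add, ih]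
    push_cast
    ring

lemma aux_sq' (s : ℕ) :
    6 * ∑ i ∈ Finset.Icc 1 (s / 2), ((s : ℤ) - 2 * (i : ℤ) + 1) ^ 2 = s * ((s : ℤ) ^ 2 - 1) := by
  have h := aux_sq s (s / 2)
  have hm : s = 2 * (s / 2) ∨ s = 2 * (s / 2) + 1 := by omega
  generalize s / 2 = m at *
  rcases hm with rfl | rfl
  · push_cast at h ⊢
    linear_combination 2 * h
  · push_cast at h ⊢
    linear_combination 2 * h

/-- centered quotient -/
def auxQ (s t z : ℤ) : ℤ := (t * z + s) / (2 * s)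

def auxR (s t z : ℤ) : ℤ := t * z - 2 * s * auxQ s t z

lemma auxR_bd (s t z : ℤ) (hs : 0 < s) : -s ≤ auxR s t z ∧ auxR s t z < s := by
  unfold auxR auxQ
  have h1 := Int.emod_add_mul_ediv (t * z + s) (2 * s)
  have h2 := Int.emod_nonneg (t * z + s) (by omega : 2 * s ≠ 0)
  have h3 := Int.emod_lt_of_pos (t * z + s) (by omega : 0 < 2 * s)
  constructor <;> linarith

noncomputable def auxZ (s : ℤ) : Finset ℤ := (Finset.Icc 1 (s - 1)).filter (fun z => z % 2 ≠ s % 2)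

lemma auxR_par (s t z : ℤ) (ht : t % 2 = 1) : auxR s t z % 2 = z % 2 := by
  unfold auxR
  rw [mul_assoc, Int.sub_mul_emod_self_left, Int.mul_emod, ht]
  simp

lemma aux_perm (s t : ℤ) (hs : 0 < s) (ht : t % 2 = 1) (hst : IsCoprime s t) :
    ∑ z ∈ auxZ s, auxR s t z ^ 2 = ∑ z ∈ auxZ s, z ^ 2 := by
  have h2t : IsCoprime (2 * s) t := by
    refine IsCoprime.mul_left ?_ hst
    exact ⟨-(t / 2), 1, by omega⟩
  have hmaps : ∀ z ∈ auxZ s, |auxR s t z| ∈ auxZ s := by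
    intro z hz
    simp only [auxZ, Finset.mem_filter, Finset.mem_Icc] at hz ⊢
    have hb := auxR_bd s t z hs
    have hp := auxR_par s t z ht
    have h0 : auxR s t z ≠ 0 := by
      intro h0
      unfold auxR at h0
      have : 2 * s ∣ t * z := ⟨auxQ s t z, by linarith⟩
      have := Int.le_of_dvd (by omega) (h2t.dvd_of_dvd_mul_left this)
      omega
    generalize auxR s t z = r at *
    rcases abs_cases r with h | h <;> omega
  have hinj : Set.InjOn (fun z => |auxR s t z|) (auxZ s) := by
    intro z hz w hw h
    simp only [auxZ, Finset.coe_filter, Set.mem_ofPred_eq, Finset.mem_Icc] at hz hw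
    simp only at h
    rcases abs_eq_abs.mp h with h | h
    · unfold auxR at h
      have : 2 * s ∣ t * (z - w) := ⟨auxQ s t z - auxQ s t w, by linarith⟩
      have h3 := Int.eq_zero_of_abs_lt_dvd (h2t.dvd_of_dvd_mul_left this)
        (by rw [abs_lt]; omega)
      omega
    · unfold auxR at h
      have : 2 * s ∣ t * (z + w) := ⟨auxQ s t z + auxQ s t w, by linarith⟩
      have h3 := Int.le_of_dvd (by omega) (h2t.dvd_of_dvd_mul_left this)
      omega
  have himg : (auxZ s).image (fun z => |auxR s t z|) = auxZ s := by
    apply Finset.eq_of_subset_of_card_le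
    · exact Finset.image_subset_iff.mpr hmaps
    · rw [Finset.card_image_of_injOn hinj]
  conv_rhs => rw [← himg]
  rw [Finset.sum_image hinj]
  simp

lemma aux_reindex (s : ℕ) (f : ℤ → ℤ) :
    ∑ i ∈ Finset.Icc 1 (s / 2), f ((s : ℤ) - 2 * (i : ℤ) + 1) = ∑ z ∈ auxZ s, f z := by
  refine Finset.sum_nbij' (fun i => (s : ℤ) - 2 * (i : ℤ) + 1) (fun z => ((s + 1 - z) / 2).toNat)
    ?_ ?_ ?_ ?_ ?_
  · intro i hi
    simp only [auxZ, Finset.mem_filter, Finset.mem_Icc] at hi ⊢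
    omega
  · intro i hi
    simp only [auxZ, Finset.mem_filter, Finset.mem_Icc] at hi ⊢
    omega
  · intro i hi
    simp only [Finset.mem_Icc] at hi ⊢
    omega
  · intro i hi
    simp only [auxZ, Finset.mem_filter, Finset.mem_Icc] at hi ⊢
    omega
  · intro i hi
    rfl

lemma aux_odd (s t : ℕ) (hs : 0 < s) (hst : Nat.Coprime s t) (hodd : t % 2 = 1) :
    24 * (∑ i ∈ Finset.Icc 1 (s / 2), ∑ j ∈ Finset.Icc 1 (t / 2),
        if 0 < fmsA s t i j then fmsA s t i j else 0) =
      ((s : ℤ) ^ 2 - 1) * ((t : ℤ) ^ 2 - 1) := by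
  have hs' : (0 : ℤ) < s := by exact_mod_cast hs
  have hrow : ∀ i ∈ Finset.Icc 1 (s / 2), 4 * (s : ℤ) * (∑ j ∈ Finset.Icc 1 (t / 2),
        if 0 < fmsA s t i j then fmsA s t i j else 0) =
        (fun z : ℤ => (t : ℤ) ^ 2 * z ^ 2 - auxR s t z ^ 2) ((s : ℤ) - 2 * (i : ℤ) + 1) := by
    intro i hi
    rw [Finset.mem_Icc] at hi
    have hA : ∀ j : ℕ, fmsA s t i j =
        (t : ℤ) * ((s : ℤ) - 2 * (i : ℤ) + 1) - (2 * (j : ℤ) - 1) * s := by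
      intro j; unfold fmsA; ring
    simp only [hA]
    have hz1 : 1 ≤ (s : ℤ) - 2 * (i : ℤ) + 1 := by omega
    have hz2 : (s : ℤ) - 2 * (i : ℤ) + 1 < s := by omega
    generalize (s : ℤ) - 2 * (i : ℤ) + 1 = z at *
    have hb := auxR_bd s t z hs'
    have hq : 0 ≤ auxQ s t z := by unfold auxQ; positivity
    unfold auxR at *
    generalize auxQ s t z = Q at *
    lift Q to ℕ using hq
    have ht' : (1 : ℤ) ≤ t := by omega
    have hle : Q ≤ t / 2 := by
      have : (2 * (Q : ℤ) - 1) < t := by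
        by_contra hc
        push Not at hc
        nlinarith
      omega
    rw [aux_row s (t * z) hs' Q hb.1 hb.2.le, min_eq_right hle]
    ring
  have hsum := Finset.sum_congr rfl hrow
  rw [← Finset.mul_sum, aux_reindex s (fun z : ℤ => (t : ℤ) ^ 2 * z ^ 2 - auxR s t z ^ 2), Finset.sum_sub_distrib, ← Finset.mul_sum,
    aux_perm s t hs' (by omega) (Nat.isCoprime_iff_coprime.mpr hst),
    ← aux_reindex s (fun z => z ^ 2)] at hsum
  have h6 := aux_sq' s
  apply mul_left_cancel₀ hs'.ne'
  linear_combination 6 * hsum + ((t : ℤ) ^ 2 - 1) * h6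

/-- The sum of the positive entries of the array `A` is `(s²−1)(t²−1)/24`. -/
theorem sum_positive_entries (s t : ℕ) (hs : 0 < s) (ht : 0 < t) (hst : Nat.Coprime s t) :
    24 * (∑ i ∈ Finset.Icc 1 (s / 2), ∑ j ∈ Finset.Icc 1 (t / 2),
        if 0 < fmsA s t i j then fmsA s t i j else 0) =
      ((s : ℤ) ^ 2 - 1) * ((t : ℤ) ^ 2 - 1) := by
  rcases Nat.mod_two_eq_zero_or_one t with h | h
  · have hs2 : s % 2 = 1 := by
      by_contra hc
      have h2 : 2 ∣ Nat.gcd s t := Nat.dvd_gcd (by omega) (by omega)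
      rw [hst] at h2
      omega
    have := aux_odd t s ht hst.symm hs2
    rw [Finset.sum_comm, mul_comm ((s : ℤ) ^ 2 - 1), ← this]
    have hA : ∀ i j : ℕ, fmsA s t i j = fmsA t s j i := by
      intro i j; unfold fmsA; ring
    simp only [hA]
  · exact aux_odd s t hs hst h
end

section
/- Let s and t be coprime positive integers, m = ⌊s/2⌋, n = ⌊t/2⌋, and A_{i,j} = st − (2j−1)s − (2i−1)t for 1 ≤ i ≤ m, 1 ≤ j ≤ n. Then the unique largest (s,t)-core partition λ satisfies MD(λ) = { A_{i,j} : 1 ≤ i ≤ m, 1 ≤ j ≤ n, A_{i,j} > 0 }, i.e., the set of its main diagonal hook lengths is exactly the set of positive entries of the array A. -/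
namespace YPartition

/-- Beads. -/
def bead (p : YPartition) (i : ℕ) : ℤ := (p.parts i : ℤ) - i - 1

/-- Holes. -/
noncomputable def hole (p : YPartition) (j : ℕ) : ℤ := (j : ℤ) - p.conj j

/-- The bead set. -/
def beads (p : YPartition) : Set ℤ := Set.range p.bead

theorem lt_conj_iff (p : YPartition) (i j : ℕ) : i < p.conj j ↔ j < p.parts i := by
  obtain ⟨N, hN⟩ := p.finite_support
  have hex : ∃ k, p.parts k ≤ j := ⟨N, by rw [hN N le_rfl]; omega⟩
  classical
  have h : {i : ℕ | j < p.parts i} = Set.Iio (Nat.find hex) := by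
    ext k
    simp only [Set.mem_ofPred_eq, Set.mem_Iio, Nat.lt_find_iff, not_le]
    constructor
    · intro h m hm
      exact lt_of_lt_of_le h (p.antitone hm)
    · intro h
      exact h k le_rfl
  have h2 : p.conj j = Nat.find hex := by
    unfold conj
    rw [h, Set.ncard_eq_toFinset_card']
    simp
  rw [h2]
  have : i ∈ {i : ℕ | j < p.parts i} ↔ i ∈ Set.Iio (Nat.find hex) := by rw [h]
  exact this.symm

theorem cell_iff (p : YPartition) (i j : ℕ) : (i, j) ∈ p.cells ↔ p.hole j < p.bead i := by
  have := p.lt_conj_iff i j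
  unfold hole bead
  change j < p.parts i ↔ _
  constructor
  · intro h
    have := this.2 h
    omega
  · intro h
    by_contra h2
    have h3 : ¬ i < p.conj j := fun h => h2 (this.1 h)
    omega

theorem hole_ne_bead (p : YPartition) (i j : ℕ) : p.bead i ≠ p.hole j := by
  have := p.lt_conj_iff i j
  unfold hole bead
  intro h
  by_cases h2 : j < p.parts i
  · have := this.2 h2
    omega
  · have h3 : ¬ i < p.conj j := fun h => h2 (this.1 h)
    omega

theorem hook_eq (p : YPartition) (i j : ℕ) (h : (i, j) ∈ p.cells) :
    (p.hook i j : ℤ) = p.bead i - p.hole j := by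
  have h1 := (p.lt_conj_iff i j).2 h
  have h2 : j < p.parts i := h
  unfold hook hole bead
  omega

theorem bead_strictAnti (p : YPartition) : StrictAnti p.bead := by
  intro i j h
  have := p.antitone h.le
  unfold bead
  omega

theorem conj_anti (p : YPartition) {i j : ℕ} (h : i ≤ j) : p.conj j ≤ p.conj i := by
  by_contra h2
  push Not at h2
  have h3 := (p.lt_conj_iff _ _).1 h2
  have h4 := (p.lt_conj_iff (p.conj i) i).2 (by omega)
  omega

theorem hole_strictMono (p : YPartition) : StrictMono p.hole := by
  intro i j h
  have := p.conj_anti h.le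
  unfold hole
  omega

theorem exists_hole (p : YPartition) (x : ℤ) (hx : x ∉ p.beads) : ∃ j, p.hole j = x := by
  classical
  obtain ⟨N, hN⟩ := p.finite_support
  have hex : ∃ i, p.bead i < x := by
    refine ⟨N + x.natAbs, ?_⟩
    unfold bead
    rw [hN _ (by omega)]
    omega
  obtain ⟨i, hi, hmin⟩ : ∃ i, p.bead i < x ∧ ∀ k < i, x < p.bead k := by
    refine ⟨Nat.find hex, Nat.find_spec hex, fun k hk => ?_⟩
    have := Nat.find_min hex hk
    have h2 : p.bead k ≠ x := fun h => hx ⟨k, h⟩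
    omega
  have hj : 0 ≤ x + i := by unfold bead at hi; omega
  refine ⟨(x + i).toNat, ?_⟩
  have h1 : ¬ i < p.conj (x + i).toNat := by
    rw [lt_conj_iff]
    unfold bead at hi
    omega
  have h2 : ¬ p.conj (x + i).toNat < i := by
    intro h
    have h3 := hmin _ h
    have h4 := (p.lt_conj_iff (p.conj (x + i).toNat) (x+i).toNat).not.1 (lt_irrefl _)
    have := p.antitone (show p.conj (x + i).toNat ≤ i - 1 by omega)
    have h5 := hmin (i-1) (by omega)
    unfold bead at h5
    omega
  unfold hole
  omega

theorem hole_notMem (p : YPartition) (j : ℕ) : p.hole j ∉ p.beads := by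
  rintro ⟨i, hi⟩
  exact p.hole_ne_bead i j hi

theorem isCore_iff (p : YPartition) (t : ℕ) (ht : 0 < t) :
    IsCore t p ↔ ∀ x ∈ p.beads, x - t ∈ p.beads := by
  constructor
  · rintro h x ⟨i, rfl⟩
    by_contra h2
    obtain ⟨j, hj⟩ := p.exists_hole _ h2
    have hc : (i, j) ∈ p.cells := by rw [cell_iff]; omega
    have := p.hook_eq i j hc
    exact h i j hc (by omega)
  · intro h i j hc he
    have := p.hook_eq i j hc
    have h2 := h _ ⟨i, rfl⟩
    apply p.hole_notMem j
    convert h2 using 1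
    omega

theorem cells_finite (p : YPartition) : p.cells.Finite := by
  obtain ⟨N, hN⟩ := p.finite_support
  apply Set.Finite.subset ((Set.finite_Iio N).prod (Set.finite_Iio (p.parts 0)))
  rintro ⟨i, j⟩ h
  have h2 : j < p.parts i := h
  have := p.antitone (Nat.zero_le i)
  simp only [Set.mem_prod, Set.mem_Iio]
  refine ⟨?_, by omega⟩
  by_contra h3
  rw [hN i (by omega)] at h2
  omega

/-- Number of inversions of difference `h`. -/
noncomputable def inv (S : Set ℤ) (h : ℤ) : ℕ := {x : ℤ | x ∈ S ∧ x - h ∉ S}.ncard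

theorem size_eq (p : YPartition) : ∃ H : ℕ, ∀ K ≥ H,
    p.size = ∑ h ∈ Finset.Icc 1 K, inv p.beads h := by
  classical
  have hf := p.cells_finite
  refine ⟨hf.toFinset.sup (fun c => p.hook c.1 c.2), fun K hK => ?_⟩
  unfold size
  rw [Set.ncard_eq_toFinset_card _ hf]
  rw [Finset.card_eq_sum_card_fiberwise (f := fun c => p.hook c.1 c.2) (t := Finset.Icc 1 K)]
  · apply Finset.sum_congr rfl
    intro h hh
    rw [Finset.mem_Icc] at hh
    unfold inv
    rw [← Set.ncard_coe_finset]
    apply Set.ncard_congr (fun c _ => p.bead c.1)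
    · rintro ⟨i, j⟩ hc
      simp only [Finset.coe_filter, Set.Finite.mem_toFinset, Set.mem_ofPred_eq] at hc ⊢
      refine ⟨⟨i, rfl⟩, ?_⟩
      have := p.hook_eq i j hc.1
      have h2 : p.bead i - h = p.hole j := by omega
      rw [h2]
      exact p.hole_notMem j
    · rintro ⟨i, j⟩ ⟨i', j'⟩ hc hc' he
      simp only [Finset.coe_filter, Set.Finite.mem_toFinset, Set.mem_ofPred_eq] at hc hc' he
      have h1 := p.hook_eq i j hc.1
      have h2 := p.hook_eq i' j' hc'.1
      have h3 : p.hole j = p.hole j' := by omega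
      rw [p.bead_strictAnti.injective he, p.hole_strictMono.injective h3]
    · rintro x ⟨⟨i, rfl⟩, h2⟩
      obtain ⟨j, hj⟩ := p.exists_hole _ h2
      have hc : (i, j) ∈ p.cells := by rw [cell_iff]; omega
      have := p.hook_eq i j hc
      refine ⟨(i, j), ?_, rfl⟩
      simp only [Finset.coe_filter, Set.Finite.mem_toFinset, Set.mem_ofPred_eq]
      exact ⟨hc, by omega⟩
  · rintro ⟨i, j⟩ hc
    rw [Set.Finite.coe_toFinset] at hc
    have h1 := p.hook_eq i j hc
    have h2 := (p.cell_iff i j).1 hc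
    have h3 := Finset.le_sup (f := fun c : ℕ × ℕ => p.hook c.1 c.2) (hf.mem_toFinset.2 hc)
    simp only at h3
    rw [Finset.mem_coe, Finset.mem_Icc]
    constructor
    · simp only; omega
    · exact h3.trans hK

/-- A partition from a cofinite set of naturals. -/
theorem exists_of_cofinite (q : ℕ → Prop) (B : ℕ) (hB : ∀ k ≥ B, q k) :
    ∃ (p : YPartition) (M : ℤ), ∀ x : ℤ, x ∈ p.beads ↔ ∃ k : ℕ, q k ∧ x = M - k := by
  classical
  have hinf : (Set.ofPred q).Infinite := by
    apply Set.Infinite.mono (s := Set.Ici B) hB (Set.Ici_infinite B)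
  have hmono : StrictMono (Nat.nth q) := Nat.nth_strictMono hinf
  have hle : ∀ i, i ≤ Nat.nth q i := fun i => hmono.le_apply
  have hstep : ∀ i, Nat.nth q i + 1 ≤ Nat.nth q (i+1) := fun i => hmono (Nat.lt_succ_self i)
  have hmono2 : Monotone (fun i => Nat.nth q i - i) := by
    apply monotone_nat_of_le_succ
    intro i
    have := hstep i
    have := hle i
    omega
  have hstep2 : ∀ i ≥ B, Nat.nth q (i+1) = Nat.nth q i + 1 := by
    intro i hi
    apply le_antisymm _ (hstep i)
    obtain ⟨n, hn⟩ : Nat.nth q i + 1 ∈ Set.range (Nat.nth q) := by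
      rw [Nat.range_nth_of_infinite hinf]
      exact hB _ (by have := hle i; omega)
    have : i < n := by
      apply hmono.lt_iff_lt.1
      omega
    rw [← hn]
    exact hmono.monotone this
  have hconst : ∀ i ≥ B, Nat.nth q i - i = Nat.nth q B - B := by
    intro i hi
    induction i, hi using Nat.le_induction with
    | base => rfl
    | succ i hi ih =>
      have := hstep2 i hi
      have := hle i
      omega
  have hbd : ∀ i, Nat.nth q i - i ≤ Nat.nth q B - B := by
    intro i
    rcases le_total B i with h | h
    · exact (hconst i h).le
    · exact hmono2 h
  let C := Nat.nth q B - B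
  refine ⟨⟨fun i => C - (Nat.nth q i - i), ?_, ⟨B, ?_⟩⟩, (C : ℤ) - 1, ?_⟩
  · intro i j hij
    have := hmono2 hij
    simp only at this ⊢
    omega
  · intro i hi
    have := hconst i hi
    simp only [C]
    omega
  · intro x
    have key : ∀ i, ((C - (Nat.nth q i - i) : ℕ) : ℤ) - i - 1 = (C : ℤ) - 1 - Nat.nth q i := by
      intro i
      have := hbd i
      have := hle i
      simp only [C]
      omega
    constructor
    · rintro ⟨i, hi⟩
      refine ⟨Nat.nth q i, Nat.nth_mem_of_infinite hinf i, ?_⟩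
      rw [← hi, ← key]
      rfl
    · rintro ⟨k, hk, rfl⟩
      obtain ⟨i, rfl⟩ : k ∈ Set.range (Nat.nth q) := by
        rw [Nat.range_nth_of_infinite hinf]; exact hk
      exact ⟨i, key i⟩

end YPartition

namespace YPartition

theorem rep_exists (s t : ℕ) (ht : 0 < t) (hst : Nat.Coprime s t) (x : ℤ) :
    ∃ l : ℕ, ∃ j : ℤ, l < t ∧ x = - (l * s) + j * t := by
  have hb := Nat.gcd_eq_gcd_ab s t
  rw [hst.gcd_eq_one] at hb
  set u := Nat.gcdA s t
  set w := Nat.gcdB s t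
  have ht' : (0 : ℤ) < t := by exact_mod_cast ht
  have h1 := Int.emod_nonneg (-(x * u)) ht'.ne'
  have h2 := Int.emod_lt_of_pos (-(x * u)) ht'
  have h3 := Int.emod_add_mul_ediv (-(x * u)) t
  set r := (-(x * u)) % (t : ℤ)
  set d := (-(x * u)) / (t : ℤ)
  refine ⟨r.toNat, x * w - d * s, by omega, ?_⟩
  rw [Int.toNat_of_nonneg h1]
  push_cast at hb
  linear_combination x * hb + (s:ℤ) * h3

theorem rep_unique (s t : ℕ) (hst : Nat.Coprime s t) (l l' : ℕ) (j j' : ℤ)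
    (hl : l < t) (hl' : l' < t) (h : -((l : ℤ) * s) + j * t = - (l' * s) + j' * t) :
    l = l' ∧ j = j' := by
  have h1 : (t : ℤ) ∣ ((l : ℤ) - l') * s := ⟨j - j', by linear_combination -h⟩
  have h2 : IsCoprime (t : ℤ) (s : ℤ) := (Nat.isCoprime_iff_coprime.2 hst).symm
  have h3 := h2.dvd_of_dvd_mul_right h1
  have h4 : (l : ℤ) - l' = 0 := by
    apply Int.eq_zero_of_abs_lt_dvd h3
    rw [abs_lt]; omega
  have h5 : l = l' := by omega
  refine ⟨h5, ?_⟩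
  subst h5
  have ht : (t : ℤ) ≠ 0 := by omega
  apply mul_right_cancel₀ ht
  linarith

theorem inv_formula (s t : ℕ) (ht : 0 < t) (hst : Nat.Coprime s t) (S : Set ℤ) (M : ℤ)
    (v : ℤ → ℤ) (hv : ∀ l j : ℤ, M - l * s + j * t ∈ S ↔ j ≤ v l) (g b : ℤ) :
    inv S (g * s - b * t) = ∑ l ∈ Finset.range t, (b - (v (l + g) - v l)).toNat := by
  classical
  have h1 : {x : ℤ | x ∈ S ∧ x - (g * s - b * t) ∉ S} =
      (((Finset.range t).sigma (fun l => Finset.Ioc (v (l + g) - b) (v l))).image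
        (fun c : (Σ _ : ℕ, ℤ) => M - c.1 * s + c.2 * t) : Finset ℤ) := by
    ext x
    simp only [Set.mem_ofPred_eq, Finset.coe_image, Set.mem_image, Finset.mem_coe,
      Finset.mem_sigma, Finset.mem_range, Finset.mem_Ioc]
    have e : ∀ l j : ℤ, M - l * s + j * t - (g * s - b * t) = M - (l + g) * s + (j + b) * t := by
      intros; ring
    constructor
    · rintro ⟨hx, hy⟩
      obtain ⟨l, j, hl, hx'⟩ := rep_exists s t ht hst (x - M)
      have hx2 : x = M - l * s + j * t := by linarith
      rw [hx2] at hx hy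
      rw [e] at hy
      rw [hv] at hx hy
      exact ⟨⟨l, j⟩, ⟨hl, by simp only; omega, hx⟩, hx2.symm⟩
    · rintro ⟨⟨l, j⟩, ⟨hl, h2, h3⟩, rfl⟩
      simp only at *
      rw [e, hv, hv]
      exact ⟨h3, by omega⟩
  unfold inv
  rw [h1, Set.ncard_coe_finset, Finset.card_image_of_injOn, Finset.card_sigma]
  · apply Finset.sum_congr rfl
    intro l _
    rw [Int.card_Ioc]
    congr 1
    ring
  · rintro ⟨l, j⟩ hc ⟨l', j'⟩ hc' he
    simp only [Finset.coe_sigma, Set.mem_sigma_iff, Finset.mem_coe, Finset.mem_range] at hc hc' he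
    obtain ⟨rfl, rfl⟩ := rep_unique s t hst l l' j j' hc.1 hc'.1 (by linarith)
    rfl

theorem sum_D (s t : ℕ) (v : ℤ → ℤ) (hper : ∀ l, v (l + t) = v l + s) (g : ℕ) :
    ∑ l ∈ Finset.range t, (v (l + g) - v l) = g * s := by
  induction g with
  | zero => simp
  | succ g ih =>
    have h : ∑ l ∈ Finset.range t, (v ((l + 1 : ℕ) + g) - v (l + g)) = s := by
      rw [Finset.sum_range_sub (fun l : ℕ => v (l + g))]
      have := hper g
      rw [add_comm] at this
      rw [this]
      simp
    have : ∑ l ∈ Finset.range t, (v (l + (g + 1 : ℕ)) - v l) =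
      ∑ l ∈ Finset.range t, (v (l + g) - v l) +
        ∑ l ∈ Finset.range t, (v ((l + 1 : ℕ) + g) - v (l + g)) := by
      rw [← Finset.sum_add_distrib]
      apply Finset.sum_congr rfl
      intro l _
      have : (l : ℤ) + (g + 1 : ℕ) = (l + 1 : ℕ) + g := by push_cast; ring
      rw [this]
      ring
    rw [this, ih, h]
    push_cast
    ring

theorem D_bounds (s t : ℕ) (v : ℤ → ℤ) (hper : ∀ l, v (l + t) = v l + s) (hm : Monotone v)
    (g : ℕ) (hg : g ≤ t) (l : ℤ) : 0 ≤ v (l + g) - v l ∧ v (l + g) - v l ≤ s := by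
  have h1 : v l ≤ v (l + g) := hm (by omega)
  have h2 : v (l + g) ≤ v (l + t) := hm (by omega)
  rw [hper] at h2
  omega

theorem term_bound (s : ℕ) (b D : ℤ) (hb : 0 ≤ b) (hbs : b ≤ s) (hD : 0 ≤ D) (hDs : D ≤ s) :
    (s : ℤ) * ((b - D).toNat : ℤ) ≤ b * (s - D) := by
  rcases le_total D b with h | h
  · rw [Int.toNat_of_nonneg (by omega)]
    nlinarith
  · rw [Int.toNat_of_nonpos (by omega)]
    simp only [Nat.cast_zero, mul_zero]
    exact mul_nonneg hb (by omega)

theorem sum_bound (s t : ℕ) (v : ℤ → ℤ) (hper : ∀ l, v (l + t) = v l + s) (g : ℕ) (b : ℤ) :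
    ∑ l ∈ Finset.range t, b * ((s : ℤ) - (v (l + g) - v l)) = s * ((t - g) * b) := by
  rw [← Finset.mul_sum, Finset.sum_sub_distrib, sum_D s t v hper g]
  simp
  ring

theorem principal_sum (s t : ℕ) (ht : 0 < t) (g : ℕ) (hg : g ≤ t) (b : ℤ) (hb : 0 ≤ b) :
    ((t : ℤ) - g) * b ≤ ((∑ l ∈ Finset.range t,
      (b - ((fun l : ℤ => (s : ℤ) * (l / t)) (l + g) - (fun l : ℤ => (s : ℤ) * (l / t)) l)).toNat
        : ℕ) : ℤ) := by
  have h1 : ∑ l ∈ Finset.range (t - g), b.toNat ≤ ∑ l ∈ Finset.range t,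
      (b - ((fun l : ℤ => (s : ℤ) * (l / t)) (l + g) -
        (fun l : ℤ => (s : ℤ) * (l / t)) l)).toNat := by
    calc _ = ∑ l ∈ Finset.range (t - g), (b - ((fun l : ℤ => (s : ℤ) * (l / t)) (l + g) -
        (fun l : ℤ => (s : ℤ) * (l / t)) l)).toNat := by
          apply Finset.sum_congr rfl
          intro l hl
          rw [Finset.mem_range] at hl
          simp only
          rw [Int.ediv_eq_zero_of_lt (by omega) (by omega),
            Int.ediv_eq_zero_of_lt (by omega) (by omega)]
          simp
      _ ≤ _ := Finset.sum_le_sum_of_subset (Finset.range_mono (by omega))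
  have h2 : ((∑ l ∈ Finset.range (t - g), b.toNat : ℕ) : ℤ) = ((t : ℤ) - g) * b := by
    simp only [Finset.sum_const, Finset.card_range, smul_eq_mul]
    push_cast [hg]
    rw [Int.toNat_of_nonneg hb]
  rw [← h2]
  exact_mod_cast h1

theorem h_rep (s t : ℕ) (hs : 0 < s) (ht : 0 < t) (hst : Nat.Coprime s t) (h : ℤ) (hh : 0 < h) :
    ∃ (g : ℕ) (b : ℤ), g < t ∧ b ≤ s ∧ h = g * s - b * t := by
  obtain ⟨l, j, hl, hx⟩ := rep_exists s t ht hst (-h)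
  refine ⟨l, j, hl, ?_, by linarith⟩
  by_contra hc
  push Not at hc
  have h1 : (l : ℤ) * s ≤ t * s := by
    apply mul_le_mul_of_nonneg_right <;> omega
  have h2 : (s : ℤ) * t ≤ j * t := by
    apply mul_le_mul_of_nonneg_right <;> omega
  nlinarith

theorem inv_le (s t : ℕ) (hs : 0 < s) (ht : 0 < t) (hst : Nat.Coprime s t) (S S' : Set ℤ)
    (M M' : ℤ)
    (v : ℤ → ℤ) (hv : ∀ l j : ℤ, M - l * s + j * t ∈ S ↔ j ≤ v l)
    (hper : ∀ l, v (l + t) = v l + s) (hm : Monotone v)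
    (hv' : ∀ l j : ℤ, M' - l * s + j * t ∈ S' ↔ j ≤ (fun l : ℤ => (s : ℤ) * (l / t)) l)
    (h : ℤ) (hh : 0 < h) : inv S h ≤ inv S' h := by
  obtain ⟨g, b, hg, hb, rfl⟩ := h_rep s t hs ht hst h hh
  rw [inv_formula s t ht hst S M v hv]
  rcases le_or_gt b 0 with hb0 | hb0
  · rw [Finset.sum_eq_zero]
    · exact Nat.zero_le _
    · intro l _
      have := D_bounds s t v hper hm g hg.le l
      rw [Int.toNat_eq_zero]
      omega
  · rw [inv_formula s t ht hst S' M' _ hv']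
    have h1 := principal_sum s t ht g hg.le b hb0.le
    have h2 : (s : ℤ) * ((∑ l ∈ Finset.range t, (b - (v (l + g) - v l)).toNat : ℕ) : ℤ) ≤
        s * (((t : ℤ) - g) * b) := by
      rw [← sum_bound s t v hper g b]
      push_cast only [Nat.cast_sum]
      rw [Finset.mul_sum]
      apply Finset.sum_le_sum
      intro l _
      have := D_bounds s t v hper hm g hg.le l
      exact term_bound s b _ hb0.le hb this.1 this.2
    have h3 := le_of_mul_le_mul_left h2 (by exact_mod_cast hs)
    exact Int.ofNat_le.1 (h3.trans h1)

theorem jump_of_eq (s t : ℕ) (hs : 0 < s) (hlt : s < t) (hst : Nat.Coprime s t) (S S' : Set ℤ)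
    (M M' : ℤ)
    (v : ℤ → ℤ) (hv : ∀ l j : ℤ, M - l * s + j * t ∈ S ↔ j ≤ v l)
    (hper : ∀ l, v (l + t) = v l + s) (hm : Monotone v)
    (hv' : ∀ l j : ℤ, M' - l * s + j * t ∈ S' ↔ j ≤ (fun l : ℤ => (s : ℤ) * (l / t)) l)
    (heq : inv S ((t : ℤ) - s) = inv S' ((t : ℤ) - s)) : ∃ l : ℤ, v (l + 1) = v l + s := by
  have ht : 0 < t := by omega
  have e : (t : ℤ) - s = ((t - 1 : ℕ) : ℤ) * s - ((s : ℤ) - 1) * t := by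
    push_cast [Nat.one_le_iff_ne_zero.2 ht.ne']
    ring
  rw [e, inv_formula s t ht hst S M v hv, inv_formula s t ht hst S' M' _ hv'] at heq
  have h1 := principal_sum s t ht (t - 1) (by omega) ((s : ℤ) - 1) (by omega)
  rw [← heq] at h1
  have h2 := sum_bound s t v hper (t-1) ((s:ℤ)-1)
  have hle : ∀ l ∈ Finset.range t,
      (s : ℤ) * ((((s : ℤ) - 1) - (v (l + (t - 1 : ℕ)) - v l)).toNat : ℤ) ≤
      ((s : ℤ) - 1) * ((s : ℤ) - (v (l + (t - 1 : ℕ)) - v l)) := by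
    intro l _
    have := D_bounds s t v hper hm (t-1) (by omega) l
    exact term_bound s _ _ (by omega) (by omega) this.1 this.2
  have h3 := (Finset.sum_eq_sum_iff_of_le hle).1 (by
    apply le_antisymm (Finset.sum_le_sum hle)
    rw [h2, ← Finset.mul_sum]
    apply mul_le_mul_of_nonneg_left _ (by omega)
    exact_mod_cast h1)
  have h4 : ∃ l ∈ Finset.range t, v (l + (t - 1 : ℕ)) - v l ≠ s := by
    by_contra hc
    push Not at hc
    have h5 := sum_D s t v hper (t-1)
    rw [Finset.sum_congr rfl hc] at h5
    simp only [Finset.sum_const, Finset.card_range, nsmul_eq_mul] at h5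
    have := mul_right_cancel₀ (by omega) h5
    omega
  obtain ⟨l, hl, hne⟩ := h4
  have h5 := h3 l hl
  have hb := D_bounds s t v hper hm (t-1) (by omega) l
  refine ⟨l - 1, ?_⟩
  have e2 : (l : ℤ) + (t - 1 : ℕ) = (l - 1) + t := by omega
  rw [e2, hper] at h5 hne hb
  rw [sub_add_cancel]
  rw [Int.toNat_of_nonneg (by omega)] at h5
  linear_combination h5

theorem exists_v (s t : ℕ) (ht : 0 < t) (S : Set ℤ) (hS : ∀ x ∈ S, x - t ∈ S)
    (B : ℤ) (hB : ∀ x ∈ S, x ≤ B) (B' : ℤ) (hB' : ∀ x ≤ B', x ∈ S) :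
    ∃ v : ℤ → ℤ, ∀ l j : ℤ, 0 - l * s + j * t ∈ S ↔ j ≤ v l := by
  have : ∀ l : ℤ, ∃ w : ℤ, ∀ j : ℤ, 0 - l * s + j * t ∈ S ↔ j ≤ w := by
    intro l
    have ht' : (1 : ℤ) ≤ t := by omega
    obtain ⟨w, hw, hmax⟩ := Int.exists_greatest_of_bdd (P := fun j : ℤ => 0 - l * s + j * t ∈ S)
      ⟨|B + l * s|, fun z hz => by
        have h1 := hB _ hz
        have h2 := le_abs_self (B + l * s)
        have h3 := abs_nonneg (B + l * s)
        by_contra hc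
        push Not at hc
        nlinarith⟩
      ⟨-|B' + l * s|, by
        apply hB'
        have h2 := neg_abs_le (B' + l * s)
        have h3 := abs_nonneg (B' + l * s)
        nlinarith⟩
    refine ⟨w, fun j => ⟨fun h => hmax j h, fun h => ?_⟩⟩
    have key : ∀ n : ℕ, 0 - l * s + (w - n) * t ∈ S := by
      intro n
      induction n with
      | zero => simpa using hw
      | succ n ih =>
        have := hS _ ih
        convert this using 1
        push_cast
        ring
    have := key (w - j).toNat
    rw [Int.toNat_of_nonneg (by omega)] at this
    convert this using 1
    ring
  choose v hv using this
  exact ⟨v, hv⟩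

theorem v_per (s t : ℕ) (S : Set ℤ) (M : ℤ)
    (v : ℤ → ℤ) (hv : ∀ l j : ℤ, M - l * s + j * t ∈ S ↔ j ≤ v l) (l : ℤ) :
    v (l + t) = v l + s := by
  have h : ∀ j : ℤ, j ≤ v (l + t) ↔ j - s ≤ v l := by
    intro j
    rw [← hv, ← hv]
    have : M - (l + t) * s + j * t = M - l * s + (j - s) * t := by ring
    rw [this]
  have h1 := (h (v (l+t))).1 le_rfl
  have h2 := (h (v l + s)).2 (by omega)
  omega

theorem v_mono (s t : ℕ) (S : Set ℤ) (hS : ∀ x ∈ S, x - s ∈ S) (M : ℤ)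
    (v : ℤ → ℤ) (hv : ∀ l j : ℤ, M - l * s + j * t ∈ S ↔ j ≤ v l) : Monotone v := by
  apply monotone_int_of_le_succ
  intro l
  rw [← hv]
  have := hS _ ((hv l (v l)).2 le_rfl)
  convert this using 1
  ring

theorem principal_of_jump (s t : ℕ) (ht : 0 < t) (hst : Nat.Coprime s t)
    (S : Set ℤ) (M : ℤ) 
    (v : ℤ → ℤ) (hv : ∀ l j : ℤ, M - l * s + j * t ∈ S ↔ j ≤ v l)
    (hm : Monotone v) (l : ℤ) (hl : v (l + 1) = v l + s) :
    ∃ N : ℤ, ∀ x : ℤ, x ∈ S ↔ ∃ a b : ℕ, x = N - a * s - b * t := by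
  have hper := v_per s t S M v hv
  refine ⟨M - (l + 1) * s + v (l + 1) * t, fun x => ⟨fun hx => ?_, ?_⟩⟩
  · obtain ⟨k, j, hk, hx'⟩ := rep_exists s t ht hst (x - (M - (l + 1) * s + v (l + 1) * t))
    have e : x = M - (l + 1 + k) * s + (v (l + 1) + j) * t := by linarith
    rw [e, hv] at hx
    have h1 : v (l + 1 + k) ≤ v (l + t) := hm (by omega)
    rw [hper] at h1
    refine ⟨k, (-j).toNat, ?_⟩
    rw [Int.toNat_of_nonneg (by omega), e]
    ring
  · rintro ⟨a, b, rfl⟩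
    have e : M - (l + 1) * s + v (l + 1) * t - a * s - b * t =
      M - (l + 1 + a) * s + (v (l + 1) - b) * t := by ring
    rw [e, hv]
    have : v (l + 1) ≤ v (l + 1 + a) := hm (by omega)
    omega

theorem sem_iff (s t : ℕ) (hst : Nat.Coprime s t) (l : ℕ) (j : ℤ) (hl : l < t) :
    (∃ a b : ℕ, (l : ℤ) * s + j * t = a * s + b * t) ↔ 0 ≤ j := by
  constructor
  · rintro ⟨a, b, h⟩
    have h0 : (a : ℤ) = (a % t : ℕ) + t * (a / t : ℕ) := by exact_mod_cast (Nat.mod_add_div a t).symm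
    have := rep_unique s t hst l (a % t) (-j) (-(b + s * (a / t : ℕ))) hl
      (Nat.mod_lt _ (by omega)) (by rw [h0] at h; linear_combination -h)
    have h2 := this.2
    have : (0 : ℤ) ≤ s * (a / t : ℕ) := by positivity
    omega
  · intro h
    exact ⟨l, j.toNat, by rw [Int.toNat_of_nonneg h]⟩

theorem sem_symm (s t : ℕ) (ht : 0 < t) (hst : Nat.Coprime s t) (z : ℤ) :
    (¬ ∃ a b : ℕ, z = a * s + b * t) ↔ ∃ a b : ℕ, (s : ℤ) * t - s - t - z = a * s + b * t := by
  obtain ⟨l, j, hl, h⟩ := rep_exists s t ht hst (-z)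
  have hz : z = l * s + (-j) * t := by linarith
  have e : (s : ℤ) * t - s - t - z = (t - 1 - l : ℕ) * s + (j - 1) * t := by
    have : ((t - 1 - l : ℕ) : ℤ) = t - 1 - l := by omega
    rw [hz, this]
    ring
  rw [e, hz, sem_iff s t hst l _ hl, sem_iff s t hst _ _ (by omega)]
  omega

theorem exists_principal (s t : ℕ) (ht : 0 < t) (hst : Nat.Coprime s t) :
    ∃ (p : YPartition) (M : ℤ), ∀ x : ℤ, x ∈ p.beads ↔ ∃ a b : ℕ, x = M - a * s - b * t := by
  obtain ⟨p, M, h⟩ := exists_of_cofinite (fun k => ∃ a b : ℕ, (k : ℤ) = a * s + b * t) (s * t) (by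
    intro k hk
    obtain ⟨l, j, hl, h⟩ := rep_exists s t ht hst (-k)
    have hz : (k : ℤ) = l * s + (-j) * t := by linarith
    rw [hz, sem_iff s t hst l _ hl]
    by_contra hc
    push Not at hc
    have h1 : (l : ℤ) * s ≤ t * s := by
      apply mul_le_mul_of_nonneg_right <;> omega
    have h2 : (s : ℤ) * t ≤ k := by exact_mod_cast hk
    nlinarith)
  refine ⟨p, M, fun x => ?_⟩
  rw [h]
  constructor
  · rintro ⟨k, ⟨a, b, hk⟩, rfl⟩
    exact ⟨a, b, by rw [hk]; ring⟩
  · rintro ⟨a, b, rfl⟩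
    exact ⟨a * s + b * t, ⟨a, b, by push_cast; rfl⟩, by push_cast; ring⟩

theorem principal_v (s t : ℕ) (ht : 0 < t) (hst : Nat.Coprime s t) (S : Set ℤ) (M : ℤ)
    (hS : ∀ x : ℤ, x ∈ S ↔ ∃ a b : ℕ, x = M - a * s - b * t) (l j : ℤ) :
    M - l * s + j * t ∈ S ↔ j ≤ (fun l : ℤ => (s : ℤ) * (l / t)) l := by
  have ht' : (0 : ℤ) < t := by omega
  have h1 := Int.emod_nonneg l ht'.ne'
  have h2 := Int.emod_lt_of_pos l ht'
  have h3 := Int.emod_add_mul_ediv l t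
  rw [hS]
  have := sem_iff s t hst (l % t).toNat (s * (l / t) - j) (by omega)
  rw [Int.toNat_of_nonneg h1] at this
  simp only
  rw [← sub_nonneg, ← this]
  have e : l % t * s + (s * (l / t) - j) * t = l * s - j * t := by
    linear_combination (s : ℤ) * h3
  rw [e]
  constructor <;> rintro ⟨a, b, h⟩ <;> exact ⟨a, b, by linarith⟩

theorem principal_of_max_aux (s t : ℕ) (hs : 0 < s) (ht : 0 < t) (hst : Nat.Coprime s t)
    (hle : s ≤ t)
    (l : YPartition) (hls : IsCore s l) (hlt : IsCore t l)
    (hmax : ∀ p : YPartition, IsCore s p → IsCore t p → p.size ≤ l.size) :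
    ∃ N : ℤ, ∀ x : ℤ, x ∈ l.beads ↔ ∃ a b : ℕ, x = N - a * s - b * t := by
  rw [isCore_iff _ _ hs] at hls
  rw [isCore_iff _ _ ht] at hlt
  obtain ⟨K, hK⟩ := l.finite_support
  obtain ⟨v, hv⟩ := exists_v s t ht l.beads hlt (l.parts 0) (by
    rintro x ⟨i, rfl⟩
    have := l.antitone (Nat.zero_le i)
    unfold bead
    omega) (-K - 1) (by
    intro x hx
    refine ⟨(-x-1).toNat, ?_⟩
    unfold bead
    rw [hK _ (by omega)]
    omega)
  have hper := v_per s t _ _ v hv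
  have hm := v_mono s t _ hls _ v hv
  have hj : ∃ l : ℤ, v (l + 1) = v l + s := by
    rcases hle.lt_or_eq with h | h
    · obtain ⟨p, M, hp⟩ := exists_principal s t ht hst
      have hv' := principal_v s t ht hst p.beads M hp
      have hsz := hmax p
        ((isCore_iff _ _ hs).2 (by
          intro x hx
          obtain ⟨a, b, rfl⟩ := (hp x).1 hx
          exact (hp _).2 ⟨a + 1, b, by push_cast; ring⟩))
        ((isCore_iff _ _ ht).2 (by
          intro x hx
          obtain ⟨a, b, rfl⟩ := (hp x).1 hx
          exact (hp _).2 ⟨a, b + 1, by push_cast; ring⟩))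
      obtain ⟨H1, hH1⟩ := l.size_eq
      obtain ⟨H2, hH2⟩ := p.size_eq
      have hH1 := hH1 (H1 + H2 + t) (by omega)
      have hH2 := hH2 (H1 + H2 + t) (by omega)
      have hle : ∀ h ∈ Finset.Icc 1 (H1 + H2 + t), inv l.beads h ≤ inv p.beads h := by
        intro h hh
        rw [Finset.mem_Icc] at hh
        exact inv_le s t hs ht hst _ _ 0 M v hv hper hm hv' h (by omega)
      have heq := (Finset.sum_eq_sum_iff_of_le hle).1
        (le_antisymm (Finset.sum_le_sum hle) (by omega)) (t - s)
        (by rw [Finset.mem_Icc]; omega)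
      rw [Nat.cast_sub h.le] at heq
      exact jump_of_eq s t hs h hst _ _ 0 M v hv hper hm hv' heq
    · subst h
      rw [Nat.coprime_self] at hst
      subst hst
      exact ⟨0, hper 0⟩
  obtain ⟨k, hk⟩ := hj
  exact principal_of_jump s t ht hst _ 0 v hv hm k hk

theorem principal_of_max (s t : ℕ) (hs : 0 < s) (ht : 0 < t) (hst : Nat.Coprime s t)
    (l : YPartition) (hls : IsCore s l) (hlt : IsCore t l)
    (hmax : ∀ p : YPartition, IsCore s p → IsCore t p → p.size ≤ l.size) :
    ∃ N : ℤ, ∀ x : ℤ, x ∈ l.beads ↔ ∃ a b : ℕ, x = N - a * s - b * t := by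
  rcases le_total s t with h | h
  · exact principal_of_max_aux s t hs ht hst h l hls hlt hmax
  · obtain ⟨N, hN⟩ := principal_of_max_aux t s ht hs hst.symm h l hlt hls
      (fun p h1 h2 => hmax p h2 h1)
    refine ⟨N, fun x => ?_⟩
    rw [hN]
    constructor <;> rintro ⟨a, b, h⟩ <;> exact ⟨b, a, by linarith⟩

theorem hole_eq (s t : ℕ) (ht : 0 < t) (hst : Nat.Coprime s t)
    (l : YPartition) (N : ℤ) (hN : ∀ x : ℤ, x ∈ l.beads ↔ ∃ a b : ℕ, x = N - a * s - b * t) :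
    2 * N = (s : ℤ) * t - s - t - 1 ∧ ∀ j, l.hole j = -1 - l.bead j := by
  have h1 : l.hole = fun j => (2 * N - ((s : ℤ) * t - s - t)) - l.bead j := by
    have hmono : StrictMono (fun j => (2 * N - ((s : ℤ) * t - s - t)) - l.bead j) := by
      intro i j hij
      have := l.bead_strictAnti hij
      simp only
      omega
    apply (StrictMono.range_inj l.hole_strictMono hmono).1
    have hc : ∀ y : ℤ, y ∉ l.beads ↔ (2 * N - ((s : ℤ) * t - s - t)) - y ∈ l.beads := by
      intro y
      rw [hN, hN]
      have := sem_symm s t ht hst (N - y)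
      constructor
      · intro h
        obtain ⟨a, b, hab⟩ := this.1 (by
          rintro ⟨a, b, hab⟩
          exact h ⟨a, b, by linarith⟩)
        exact ⟨a, b, by linarith⟩
      · rintro ⟨a, b, hab⟩ ⟨a', b', hab'⟩
        exact this.2 ⟨a, b, by linarith⟩ ⟨a', b', by linarith⟩
    ext y
    constructor
    · rintro ⟨j, rfl⟩
      obtain ⟨i, hi⟩ := (hc _).1 (l.hole_notMem j)
      exact ⟨i, by simp only; omega⟩
    · rintro ⟨i, rfl⟩
      apply l.exists_hole
      rw [hc]
      exact ⟨i, by simp only; omega⟩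
  obtain ⟨K, hK⟩ := l.finite_support
  have h2 := congrFun h1 (K + l.parts 0)
  have h3 : ¬ 0 < l.conj (K + l.parts 0) := by
    rw [lt_conj_iff]
    omega
  simp only [hole, bead] at h2
  rw [hK (K + l.parts 0) (by omega)] at h2
  have h4 : 2 * N = (s : ℤ) * t - s - t - 1 := by
    have : l.conj (K + l.parts 0) = 0 := by omega
    rw [this] at h2
    push_cast at h2
    linarith
  refine ⟨h4, fun j => ?_⟩
  rw [h1]
  simp only
  linarith

end YPartition

open YPartition in
/-- The main diagonal hook length set of the largest `(s,t)`-core partition is exactly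
the set of positive entries of the array `A`. -/
theorem MD_of_largest_core (s t : ℕ) (hs : 0 < s) (ht : 0 < t) (hst : Nat.Coprime s t)
    (l : YPartition) (hls : IsCore s l) (hlt : IsCore t l)
    (hmax : ∀ p : YPartition, IsCore s p → IsCore t p → p.size ≤ l.size) :
    l.MD = {h : ℕ | ∃ i j : ℕ, 1 ≤ i ∧ i ≤ s / 2 ∧ 1 ≤ j ∧ j ≤ t / 2 ∧
      0 < fmsA s t i j ∧ (h : ℤ) = fmsA s t i j} := by
  obtain ⟨N, hN⟩ := principal_of_max s t hs ht hst l hls hlt hmax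
  obtain ⟨h2, hhole⟩ := hole_eq s t ht hst l N hN
  ext h
  constructor
  · rintro ⟨i, hi, rfl⟩
    have h3 := l.hook_eq i i hi
    rw [hhole] at h3
    obtain ⟨a, b, hab⟩ := (hN (l.bead i)).1 ⟨i, rfl⟩
    have h4 : 0 ≤ l.bead i := by unfold bead; omega
    have h5 : (l.hook i i : ℤ) = fmsA s t (b + 1) (a + 1) := by
      unfold fmsA
      rw [h3, hab]
      push_cast
      linear_combination h2
    have hpos : 0 < fmsA s t (b + 1) (a + 1) := by rw [← h5]; omega
    have hpos' := hpos
    unfold fmsA at hpos'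
    push_cast at hpos'
    refine ⟨b + 1, a + 1, by omega, ?_, by omega, ?_, hpos, h5⟩
    · have : (2 * (b : ℤ) + 1) * t < s * t := by nlinarith
      have := lt_of_mul_lt_mul_right this (by omega)
      omega
    · have : (2 * (a : ℤ) + 1) * s < t * s := by nlinarith
      have := lt_of_mul_lt_mul_right this (by omega)
      omega
  · rintro ⟨i, j, hi, _, hj, _, hpos, hh⟩
    obtain ⟨b, rfl⟩ := Nat.exists_eq_add_of_le' hi
    obtain ⟨a, rfl⟩ := Nat.exists_eq_add_of_le' hj
    obtain ⟨k, hk⟩ := (hN (N - a * s - b * t)).2 ⟨a, b, rfl⟩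
    have h5 : fmsA s t (b + 1) (a + 1) = 2 * l.bead k + 1 := by
      unfold fmsA
      rw [hk]
      push_cast
      linear_combination -h2
    have hc : k < l.parts k := by
      have : 0 ≤ l.bead k := by omega
      unfold bead at this
      omega
    refine ⟨k, hc, ?_⟩
    have h3 := l.hook_eq k k hc
    rw [hhole] at h3
    omega
end

section
/- Let s and t be coprime positive integers, m = ⌊s/2⌋, n = ⌊t/2⌋, and A_{i,j} = st − (2j−1)s − (2i−1)t. Then every self-conjugate (s,t)-core partition λ satisfies |λ| = (s²−1)(t²−1)/24 − Σ_{(i,j): A_{i,j}>0, A_{i,j}∉MD(λ)} A_{i,j} − Σ_{(i,j): A_{i,j}<0, −A_{i,j}∈MD(λ)} A_{i,j}, where both sums range over 1 ≤ i ≤ m, 1 ≤ j ≤ n. -/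
namespace FMSProof

open YPartition

/-! ### Arithmetic of the array -/

lemma sum_lin (x s : ℤ) (k : ℕ) :
    ∑ j ∈ Finset.Icc 1 k, (x - (2 * (j : ℤ) - 1) * s) = k * x - k ^ 2 * s := by
  induction k with
  | zero => simp
  | succ k ih =>
    rw [Finset.sum_Icc_succ_top (by omega), ih]
    push_cast
    ring

/-- Sum of positive terms of a progression. -/
lemma sum_pos_row (x s : ℤ) (hs : 0 < s) (k N : ℕ) (hkN : k ≤ N)
    (h1 : (2 * (k : ℤ) - 1) * s < x) (h2 : x ≤ (2 * (k : ℤ) + 1) * s) :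
    4 * s * ∑ j ∈ Finset.Icc 1 N,
      (if 0 < x - (2 * (j : ℤ) - 1) * s then x - (2 * (j : ℤ) - 1) * s else 0)
      = x ^ 2 - (x - 2 * k * s) ^ 2 := by
  rw [← Finset.sum_filter]
  have : (Finset.Icc 1 N).filter (fun j : ℕ => 0 < x - (2 * (j : ℤ) - 1) * s)
      = Finset.Icc 1 k := by
    ext j
    simp only [Finset.mem_filter, Finset.mem_Icc]
    constructor
    · rintro ⟨⟨h3, h4⟩, h5⟩
      refine ⟨h3, ?_⟩
      by_contra h
      have h6 : (k : ℤ) + 1 ≤ j := by exact_mod_cast Nat.lt_of_not_le h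
      nlinarith
    · rintro ⟨h3, h4⟩
      refine ⟨⟨h3, by omega⟩, ?_⟩
      have h6 : (j : ℤ) ≤ k := by exact_mod_cast h4
      nlinarith
  rw [this, sum_lin]
  ring

lemma sum_sq (s : ℕ) :
    6 * ∑ i ∈ Finset.Icc 1 (s / 2), ((s : ℤ) - (2 * (i : ℤ) - 1)) ^ 2
      = s * ((s : ℤ) ^ 2 - 1) := by
  have key : ∀ (m : ℕ) (x : ℤ), 3 * ∑ i ∈ Finset.Icc 1 m, (x - (2 * (i : ℤ) - 1)) ^ 2
      = 3 * m * x ^ 2 - 6 * m ^ 2 * x + m * (4 * m ^ 2 - 1) := by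
    intro m x
    induction m with
    | zero => simp
    | succ k ih =>
      rw [Finset.sum_Icc_succ_top (by omega), mul_add, ih]
      push_cast
      ring
  have h := key (s / 2) s
  obtain ⟨k, hk | hk⟩ := Nat.even_or_odd' s
  · have : s / 2 = k := by omega
    rw [this] at h ⊢
    subst hk
    push_cast at h ⊢
    linear_combination 2 * h
  · have : s / 2 = k := by omega
    rw [this] at h ⊢
    subst hk
    push_cast at h ⊢
    linear_combination 2 * h

/-- The number of positive entries in row `i`. -/
def cnt (s t i : ℕ) : ℕ := ((s - (2 * i - 1)) * t + s - 1) / (2 * s)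

/-- The centred residue. -/
def res (s t i : ℕ) : ℤ := ((s : ℤ) - (2 * (i : ℤ) - 1)) * t - 2 * (cnt s t i) * s

lemma cnt_spec (s t i : ℕ) (hs : 0 < s) (ht : 0 < t) (h1 : 1 ≤ i) (h2 : i ≤ s / 2) :
    (2 * (cnt s t i : ℤ) - 1) * s < ((s : ℤ) - (2 * (i : ℤ) - 1)) * t ∧
    ((s : ℤ) - (2 * (i : ℤ) - 1)) * t ≤ (2 * (cnt s t i : ℤ) + 1) * s ∧
    cnt s t i ≤ t / 2 := by
  have hb : 2 * i - 1 ≤ s := by omega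
  have hc : ((s - (2 * i - 1) : ℕ) : ℤ) = (s : ℤ) - (2 * (i : ℤ) - 1) := by
    push_cast [Nat.cast_sub hb, Nat.cast_sub (show 1 ≤ 2 * i by omega)]
    ring
  have hd := Nat.div_add_mod ((s - (2 * i - 1)) * t + s - 1) (2 * s)
  have hm := Nat.mod_lt ((s - (2 * i - 1)) * t + s - 1) (show 0 < 2 * s by omega)
  change 2 * s * cnt s t i + _ = _ at hd
  set y := (s - (2 * i - 1)) * t with hy
  have hyc : (y : ℤ) = ((s : ℤ) - (2 * (i : ℤ) - 1)) * t := by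
    rw [hy, Nat.cast_mul, hc]
  rw [← hyc]
  have e1 : 2 * s * cnt s t i ≤ y + s - 1 := by omega
  have e2 : y + s - 1 < 2 * s * cnt s t i + 2 * s := by omega
  have e1' : 2 * (s : ℤ) * cnt s t i + 1 ≤ y + s := by
    have : 2 * s * cnt s t i + 1 ≤ y + s := by omega
    exact_mod_cast this
  have e2' : (y : ℤ) + s ≤ 2 * s * cnt s t i + 2 * s := by
    have : y + s ≤ 2 * s * cnt s t i + 2 * s := by omega
    exact_mod_cast this
  have a1 : (2 * (cnt s t i : ℤ) - 1) * s < y := by nlinarith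
  refine ⟨a1, by nlinarith, ?_⟩
  have hlt : (2 * (cnt s t i : ℤ) - 1) * s < t * s := by
    rw [hyc] at a1
    have : (1 : ℤ) ≤ i := by exact_mod_cast h1
    have : (0 : ℤ) < t := by exact_mod_cast ht
    nlinarith
  have := lt_of_mul_lt_mul_right hlt (by positivity)
  omega

lemma res_parity (s t i : ℕ) (hst : Nat.Coprime s t) : (res s t i - (s + 1)) % 2 = 0 := by
  have : Odd s ∨ (Even s ∧ Odd t) := by
    rcases Nat.even_or_odd s with h | h
    · right
      refine ⟨h, ?_⟩
      by_contra h'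
      have h' := Nat.not_odd_iff_even.1 h'
      have := Nat.dvd_gcd h.two_dvd h'.two_dvd
      rw [hst] at this
      omega
    · exact Or.inl h
  apply Int.emod_eq_zero_of_dvd
  unfold res
  rcases this with ⟨k, hk⟩ | ⟨⟨k, hk⟩, ⟨l, hl⟩⟩
  · rw [hk]
    push_cast
    exact ⟨(k - i + 1) * t - cnt (2 * k + 1) t i * (2 * k + 1) - (k + 1), by ring⟩
  · rw [hk, hl]
    push_cast
    exact ⟨(k - i) * (2 * l + 1) + l - cnt (k+k) (2 * l + 1) i * (k + k) - k, by ring⟩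

lemma dvd_of_even_mul (s t : ℕ) (hst : Nat.Coprime s t) (c : ℤ)
    (hc : (2 : ℤ) ∣ c) (h : (2 * (s : ℤ)) ∣ c * t) : (2 * (s : ℤ)) ∣ c := by
  obtain ⟨e, rfl⟩ := hc
  rw [mul_assoc] at h
  have := Int.dvd_of_mul_dvd_mul_left (by norm_num) h
  exact mul_dvd_mul_left 2 (IsCoprime.dvd_of_dvd_mul_right (Nat.isCoprime_iff_coprime.2 hst) this)

lemma res_range (s t i : ℕ) (hs : 0 < s) (ht : 0 < t) (hst : Nat.Coprime s t)
    (h1 : 1 ≤ i) (h2 : i ≤ s / 2) : 1 ≤ |res s t i| ∧ |res s t i| ≤ s - 1 := by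
  obtain ⟨a, b, _⟩ := cnt_spec s t i hs ht h1 h2
  have hp := res_parity s t i hst
  have a' : -(s : ℤ) < res s t i := by unfold res; linarith
  have b' : res s t i ≤ s := by unfold res; linarith
  have hne : res s t i ≠ 0 := by
    intro h0
    rw [h0] at hp
    have hdv : (2 * (s : ℤ)) ∣ ((s : ℤ) - (2 * (i : ℤ) - 1)) * t :=
      ⟨cnt s t i, by unfold res at h0; linear_combination h0⟩
    have := dvd_of_even_mul s t hst _ (by omega) hdv
    have := Int.le_of_dvd (by omega) this
    omega
  have hb2 : res s t i ≠ s := by omega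
  constructor
  · exact Int.one_le_abs hne
  · rw [abs_le]; omega

lemma sum_res (s t : ℕ) (hs : 0 < s) (ht : 0 < t) (hst : Nat.Coprime s t) :
    ∑ i ∈ Finset.Icc 1 (s / 2), (res s t i) ^ 2
      = ∑ i ∈ Finset.Icc 1 (s / 2), ((s : ℤ) - (2 * (i : ℤ) - 1)) ^ 2 := by
  set σ : ℕ → ℕ := fun i => (((s : ℤ) + 1 - |res s t i|) / 2).toNat with hσ
  have spec : ∀ i ∈ Finset.Icc 1 (s / 2), 1 ≤ σ i ∧ σ i ≤ s / 2 ∧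
      (s : ℤ) - (2 * (σ i : ℤ) - 1) = |res s t i| := by
    intro i hi
    rw [Finset.mem_Icc] at hi
    obtain ⟨a, b⟩ := res_range s t i hs ht hst hi.1 hi.2
    have hp := res_parity s t i hst
    have hp' : (|res s t i| - (s + 1)) % 2 = 0 := by
      rcases abs_choice (res s t i) with h | h <;> rw [h] <;> omega
    simp only [hσ]
    omega
  have maps : Set.MapsTo σ (Finset.Icc 1 (s / 2)) (Finset.Icc 1 (s / 2)) := by
    intro i hi
    have := spec i hi
    simp only [Finset.coe_Icc, Set.mem_Icc]
    exact ⟨this.1, this.2.1⟩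
  have inj : Set.InjOn σ (Finset.Icc 1 (s / 2)) := by
    intro i hi j hj hij
    have e1 := (spec i hi).2.2
    have e2 := (spec j hj).2.2
    rw [hij] at e1
    simp only [Finset.coe_Icc, Set.mem_Icc] at hi hj
    have hab : |res s t i| = |res s t j| := by linarith
    rcases abs_eq_abs.1 hab with h | h
    · have hdv : (2 * (s : ℤ)) ∣ (2 * ((j : ℤ) - i)) * t :=
        ⟨cnt s t i - cnt s t j, by unfold res at h; linear_combination h⟩
      have := dvd_of_even_mul s t hst _ ⟨_, rfl⟩ hdv
      have := Int.eq_zero_of_abs_lt_dvd this (by rw [abs_lt]; omega)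
      omega
    · have hdv : (2 * (s : ℤ)) ∣ (2 * ((s : ℤ) - i - j + 1)) * t :=
        ⟨cnt s t i + cnt s t j, by unfold res at h; linear_combination h⟩
      have := dvd_of_even_mul s t hst _ ⟨_, rfl⟩ hdv
      have := Int.le_of_dvd (by omega) this
      omega
  refine Finset.sum_nbij σ maps inj
    (Finset.surjOn_of_injOn_of_card_le σ maps inj le_rfl) ?_
  intro i hi
  rw [(spec i hi).2.2, sq_abs]

lemma sum_positive (s t : ℕ) (hs : 0 < s) (ht : 0 < t) (hst : Nat.Coprime s t) :
    24 * ∑ i ∈ Finset.Icc 1 (s / 2), ∑ j ∈ Finset.Icc 1 (t / 2),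
      (if 0 < fmsA s t i j then fmsA s t i j else 0)
      = ((s : ℤ) ^ 2 - 1) * ((t : ℤ) ^ 2 - 1) := by
  have hs' : (0 : ℤ) < s := by exact_mod_cast hs
  have h : 4 * (s : ℤ) * ∑ i ∈ Finset.Icc 1 (s / 2), ∑ j ∈ Finset.Icc 1 (t / 2),
      (if 0 < fmsA s t i j then fmsA s t i j else 0)
      = ∑ i ∈ Finset.Icc 1 (s / 2), (((s : ℤ) - (2 * (i : ℤ) - 1)) ^ 2 * t ^ 2
          - (res s t i) ^ 2) := by
    rw [Finset.mul_sum]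
    refine Finset.sum_congr rfl fun i hi => ?_
    rw [Finset.mem_Icc] at hi
    obtain ⟨a, b, c⟩ := cnt_spec s t i hs ht hi.1 hi.2
    have := sum_pos_row _ s hs' _ _ c a b
    rw [← mul_pow]
    unfold res
    rw [← this]
    congr 1
    refine Finset.sum_congr rfl fun j _ => ?_
    have : fmsA s t i j = ((s : ℤ) - (2 * (i : ℤ) - 1)) * t - (2 * (j : ℤ) - 1) * s := by
      unfold fmsA; ring
    rw [this]
  rw [Finset.sum_sub_distrib, sum_res s t hs ht hst, ← Finset.sum_mul] at h
  have h6 := sum_sq s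
  apply mul_left_cancel₀ hs'.ne'
  linear_combination 6 * h + ((t : ℤ) ^ 2 - 1) * h6

/-! ### Gaps of the semigroup are the absolute values of the entries -/

lemma gap_eq (s t : ℕ) (ht : 0 < t) (hst : Nat.Coprime s t) (d : ℤ)
    (hd : 0 < d) (hodd : d % 2 = 1)
    (hgap : ∀ u v : ℕ, d ≠ u * s + v * t) :
    ∃ i ∈ Finset.Icc 1 (s / 2), ∃ j ∈ Finset.Icc 1 (t / 2), |fmsA s t i j| = d := by
  have ht' : (0 : ℤ) < t := by exact_mod_cast ht
  obtain ⟨p, q, hpq⟩ := Nat.isCoprime_iff_coprime.2 hst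
  set a := (-d * p) % t with ha
  have ha0 : 0 ≤ a := Int.emod_nonneg _ ht'.ne'
  have hat : a < t := Int.emod_lt_of_pos _ ht'
  have hda := Int.emod_add_mul_ediv (-d * p) t
  rw [← ha] at hda
  obtain ⟨b, hb⟩ : ∃ b : ℤ, d = s * t - a * s - b * t :=
    ⟨s - q * d + s * ((-d * p) / t), by linear_combination -d * hpq + s * hda⟩
  have hs0 : (0 : ℤ) ≤ s := by positivity
  have hbpos : 0 < b := by
    by_contra hneg
    apply hgap (t - a).toNat (-b).toNat
    rw [Int.toNat_of_nonneg (by omega), Int.toNat_of_nonneg (by omega), hb]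
    ring
  have hbs : b < s := by
    by_contra hge
    nlinarith [mul_nonneg ha0 hs0]
  have hapos : 0 < a := by
    rcases ha0.lt_or_eq with h | h
    · exact h
    · exfalso
      apply hgap 0 (s - b).toNat
      rw [Int.toNat_of_nonneg (by omega), hb, ← h]
      push_cast
      ring
  -- choose the representation with odd coefficients
  have main : ∀ a' b' : ℤ, 0 < a' → a' < t → 0 < b' → b' < s → a' % 2 = 1 → b' % 2 = 1 →
      |(s : ℤ) * t - a' * s - b' * t| = d →
      ∃ i ∈ Finset.Icc 1 (s / 2), ∃ j ∈ Finset.Icc 1 (t / 2), |fmsA s t i j| = d := by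
    intro a' b' h1 h2 h3 h4 h5 h6 h7
    refine ⟨((b' + 1) / 2).toNat, ?_, ((a' + 1) / 2).toNat, ?_, ?_⟩
    · rw [Finset.mem_Icc]; omega
    · rw [Finset.mem_Icc]; omega
    · unfold fmsA
      have e1 : 2 * ((((a' + 1) / 2).toNat : ℕ) : ℤ) - 1 = a' := by omega
      have e2 : 2 * ((((b' + 1) / 2).toNat : ℕ) : ℤ) - 1 = b' := by omega
      rw [e1, e2, h7]
  have hA : a % 2 = 1 → b % 2 = 1 → ∃ i ∈ Finset.Icc 1 (s / 2),
      ∃ j ∈ Finset.Icc 1 (t / 2), |fmsA s t i j| = d := fun h1 h2 =>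
    main a b hapos hat hbpos hbs h1 h2 (by rw [← hb, abs_of_pos hd])
  have hB : ((t : ℤ) - a) % 2 = 1 → ((s : ℤ) - b) % 2 = 1 → ∃ i ∈ Finset.Icc 1 (s / 2),
      ∃ j ∈ Finset.Icc 1 (t / 2), |fmsA s t i j| = d := fun h1 h2 =>
    main (t - a) (s - b) (by omega) (by omega) (by omega) (by omega) h1 h2 (by
      have : (s : ℤ) * t - (t - a) * s - (s - b) * t = -d := by rw [hb]; ring
      rw [this, abs_neg, abs_of_pos hd])
  have hpar : ((s : ℤ) * t - a * s - b * t) % 2 = 1 := by rw [← hb]; exact hodd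
  have hnot : ¬ ((s : ℤ) % 2 = 0 ∧ (t : ℤ) % 2 = 0) := by
    rintro ⟨h1, h2⟩
    have := Nat.dvd_gcd (show 2 ∣ s by omega) (show 2 ∣ t by omega)
    rw [hst] at this
    omega
  rcases Int.emod_two_eq_zero_or_one (s : ℤ) with e1 | e1 <;>
  rcases Int.emod_two_eq_zero_or_one (t : ℤ) with e2 | e2 <;>
  rcases Int.emod_two_eq_zero_or_one a with e3 | e3 <;>
  rcases Int.emod_two_eq_zero_or_one b with e4 | e4 <;>
  first
  | (exfalso; omega)
  | exact hA e3 e4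
  | exact hB (by omega) (by omega)
  | (exfalso; simp [Int.sub_emod, Int.mul_emod, e1, e2, e3, e4] at hpar)

lemma abs_inj (s t : ℕ) (hst : Nat.Coprime s t) (i j i' j' : ℕ)
    (hi : i ∈ Finset.Icc 1 (s / 2)) (hj : j ∈ Finset.Icc 1 (t / 2))
    (hi' : i' ∈ Finset.Icc 1 (s / 2)) (hj' : j' ∈ Finset.Icc 1 (t / 2))
    (h : |fmsA s t i j| = |fmsA s t i' j'|) : i = i' ∧ j = j' := by
  rw [Finset.mem_Icc] at hi hj hi' hj'
  have hc : IsCoprime (s : ℤ) t := Nat.isCoprime_iff_coprime.2 hst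
  unfold fmsA at h
  rcases abs_eq_abs.1 h with h | h
  · have d1 : (s : ℤ) ∣ (2 * ((i : ℤ) - i')) * t := ⟨2 * (j' - j), by linear_combination -h⟩
    have d2 : (t : ℤ) ∣ (2 * ((j : ℤ) - j')) * s := ⟨2 * (i' - i), by linear_combination -h⟩
    have f1 := Int.eq_zero_of_abs_lt_dvd (hc.dvd_of_dvd_mul_right d1) (by rw [abs_lt]; omega)
    have f2 := Int.eq_zero_of_abs_lt_dvd (hc.symm.dvd_of_dvd_mul_right d2)
      (by rw [abs_lt]; omega)
    omega
  · exfalso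
    have d1 : (s : ℤ) ∣ (2 * ((i : ℤ) + i' - 1)) * t :=
      ⟨2 * t - 2 * (j' + j - 1), by linear_combination -h⟩
    have d2 : (t : ℤ) ∣ (2 * ((j : ℤ) + j' - 1)) * s :=
      ⟨2 * s - 2 * (i' + i - 1), by linear_combination -h⟩
    have f1 := Int.eq_zero_of_abs_lt_dvd
      (Int.dvd_sub (hc.dvd_of_dvd_mul_right d1) (dvd_refl (s : ℤ))) (by rw [abs_lt]; omega)
    have f2 := Int.eq_zero_of_abs_lt_dvd
      (Int.dvd_sub (hc.symm.dvd_of_dvd_mul_right d2) (dvd_refl (t : ℤ))) (by rw [abs_lt]; omega)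
    have := Nat.dvd_gcd (show 2 ∣ s by omega) (show 2 ∣ t by omega)
    rw [hst] at this
    omega

/-! ### Self-conjugate partitions -/

lemma lt_conj_iff (l : YPartition) (i j : ℕ) : i < l.conj j ↔ j < l.parts i := by
  classical
  obtain ⟨N, hN⟩ := l.finite_support
  have hex : ∃ k, ¬ j < l.parts k := ⟨N, by rw [hN N le_rfl]; omega⟩
  have hset : {i : ℕ | j < l.parts i} = Set.Iio (Nat.find hex) := by
    ext k
    simp only [Set.mem_ofPred_eq, Set.mem_Iio]
    constructor
    · intro hk
      by_contra hge
      have h1 := Nat.find_spec hex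
      have h2 := l.antitone (Nat.le_of_not_lt hge)
      omega
    · intro hk
      have := Nat.find_min hex hk
      omega
  have hcard : l.conj j = Nat.find hex := by
    unfold YPartition.conj
    rw [hset, ← Finset.coe_Iio, Set.ncard_coe_finset, Nat.card_Iio]
  have hm : i ∈ {i : ℕ | j < l.parts i} ↔ i ∈ Set.Iio (Nat.find hex) := by rw [hset]
  rw [hcard]
  exact hm.symm

lemma symm_cells (l : YPartition) (hl : l.SelfConj) (i j : ℕ) :
    i < l.parts j ↔ j < l.parts i := by
  rw [← hl j]
  exact lt_conj_iff l i j

/-- The (shifted) beta-set. -/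
def beta (l : YPartition) : Set ℤ := {y | ∃ i : ℕ, y = (l.parts i : ℤ) - i}

lemma beta_not (l : YPartition) (hl : l.SelfConj) (y : ℤ) (h1 : y ∈ beta l)
    (h2 : 1 - y ∈ beta l) : False := by
  obtain ⟨i, hi⟩ := h1
  obtain ⟨j, hj⟩ := h2
  have := symm_cells l hl i j
  omega

lemma beta_or (l : YPartition) (hl : l.SelfConj) (y : ℤ) (h : y ∉ beta l) :
    1 - y ∈ beta l := by
  classical
  have hex : ∃ i : ℕ, (l.parts i : ℤ) - i ≤ y := by
    refine ⟨l.parts 0 + y.natAbs, ?_⟩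
    have := l.antitone (Nat.zero_le (l.parts 0 + y.natAbs))
    omega
  obtain ⟨i, hi, hmin⟩ : ∃ i : ℕ, (l.parts i : ℤ) - i ≤ y ∧
      ∀ k < i, ¬ (l.parts k : ℤ) - k ≤ y :=
    ⟨Nat.find hex, Nat.find_spec hex, fun k hk => Nat.find_min hex hk⟩
  have hne : (l.parts i : ℤ) - i ≠ y := fun h' => h ⟨i, h'.symm⟩
  obtain ⟨j, hj⟩ : ∃ j : ℕ, (j : ℤ) = y + i - 1 := ⟨(y + i - 1).toNat, by omega⟩
  refine ⟨j, ?_⟩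
  have h1 := symm_cells l hl i j
  rcases Nat.eq_zero_or_pos i with h0 | h0
  · omega
  · have h2 := symm_cells l hl (i - 1) j
    have h3 := hmin (i - 1) (by omega)
    omega

lemma beta_sub (l : YPartition) (hl : l.SelfConj) (s : ℕ) (hs : 0 < s) (hc : IsCore s l)
    (y : ℤ) (hy : y ∈ beta l) : y - s ∈ beta l := by
  by_contra h
  obtain ⟨j, hj⟩ := beta_or l hl _ h
  obtain ⟨i, hi⟩ := hy
  have h1 := symm_cells l hl i j
  apply hc i j
  · change j < l.parts i
    omega
  · unfold YPartition.hook
    rw [hl j]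
    omega

lemma beta_sub_mul (l : YPartition) (hl : l.SelfConj) (s : ℕ) (hs : 0 < s) (hc : IsCore s l)
    (u : ℕ) (y : ℤ) (hy : y ∈ beta l) : y - u * s ∈ beta l := by
  induction u with
  | zero => simpa using hy
  | succ u ih =>
    have := beta_sub l hl s hs hc _ ih
    convert this using 1
    push_cast
    ring

lemma md_gap (s t : ℕ) (hs : 0 < s) (ht : 0 < t) (l : YPartition) (hl : l.SelfConj)
    (hls : IsCore s l) (hlt : IsCore t l) (d : ℕ) (hd : d ∈ l.MD) :
    d % 2 = 1 ∧ ∀ u v : ℕ, (d : ℤ) ≠ u * s + v * t := by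
  obtain ⟨i, hi, hdi⟩ := hd
  unfold YPartition.hook at hdi
  rw [hl i] at hdi
  refine ⟨by omega, fun u v huv => ?_⟩
  have hy : (l.parts i : ℤ) - i ∈ beta l := ⟨i, rfl⟩
  apply beta_not l hl _ hy
  have := beta_sub_mul l hl t ht hlt v _ (beta_sub_mul l hl s hs hls u _ hy)
  convert this using 1
  have : (d : ℤ) = 2 * ((l.parts i : ℤ) - i) - 1 := by omega
  linarith

/-- The diagonal length. -/
lemma exists_durfee (l : YPartition) : ∃ D : ℕ, ∀ i, i < D ↔ i < l.parts i := by
  classical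
  obtain ⟨N, hN⟩ := l.finite_support
  have hex : ∃ k, ¬ k < l.parts k := ⟨N, by rw [hN N le_rfl]; omega⟩
  refine ⟨Nat.find hex, fun i => ⟨fun h => ?_, fun h => ?_⟩⟩
  · have := Nat.find_min hex h
    omega
  · by_contra hge
    have h1 := Nat.find_spec hex
    have h2 := l.antitone (Nat.le_of_not_lt hge)
    omega

lemma size_eq (l : YPartition) (hl : l.SelfConj) (D : ℕ) (hD : ∀ i, i < D ↔ i < l.parts i) :
    l.size = ∑ i ∈ Finset.range D, l.hook i i := by
  classical
  set B : ℕ → Finset (ℕ × ℕ) := fun k =>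
    (Finset.Ico k (l.parts k)).image (fun j => (k, j)) ∪
    (Finset.Ioo k (l.parts k)).image (fun i => (i, k)) with hB
  have hmem : ∀ k c, c ∈ B k ↔ (c.1 = k ∧ k ≤ c.2 ∧ c.2 < l.parts k) ∨
      (c.2 = k ∧ k < c.1 ∧ c.1 < l.parts k) := by
    rintro k ⟨x, y⟩
    simp only [hB, Finset.mem_union, Finset.mem_image, Finset.mem_Ico, Finset.mem_Ioo,
      Prod.mk.injEq]
    constructor
    · rintro (⟨a, h, h1, h2⟩ | ⟨a, h, h1, h2⟩)
      · left; omega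
      · right; omega
    · rintro (⟨h1, h2, h3⟩ | ⟨h1, h2, h3⟩)
      · left; exact ⟨y, ⟨h2, h3⟩, h1.symm, rfl⟩
      · right; exact ⟨x, ⟨h2, h3⟩, rfl, h1.symm⟩
  have hcells : l.cells = ↑((Finset.range D).biUnion B) := by
    ext ⟨x, y⟩
    simp only [YPartition.cells, Set.mem_ofPred_eq, Finset.coe_biUnion, Set.mem_iUnion,
      Finset.mem_coe, Finset.mem_range, hmem, exists_prop]
    have hsy := symm_cells l hl x y
    constructor
    · intro h
      rcases le_or_gt x y with hxy | hxy
      · exact ⟨x, (hD x).2 (by omega), Or.inl ⟨rfl, hxy, h⟩⟩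
      · exact ⟨y, (hD y).2 (by omega), Or.inr ⟨rfl, hxy, by omega⟩⟩
    · rintro ⟨k, hk, ⟨h1, h2, h3⟩ | ⟨h1, h2, h3⟩⟩
      · subst h1; exact h3
      · subst h1; omega
  unfold YPartition.size
  rw [hcells, Set.ncard_coe_finset, Finset.card_biUnion]
  · refine Finset.sum_congr rfl fun k hk => ?_
    have hk' := (hD k).1 (Finset.mem_range.1 hk)
    simp only [hB]
    rw [Finset.card_union_of_disjoint, Finset.card_image_of_injective,
      Finset.card_image_of_injective, Nat.card_Ico, Nat.card_Ioo]
    · unfold YPartition.hook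
      rw [hl k]
      omega
    · intro a b h
      simpa using h
    · intro a b h
      simpa using h
    · rw [Finset.disjoint_left]
      rintro ⟨x, y⟩ h1 h2
      simp only [Finset.mem_image, Finset.mem_Ico, Finset.mem_Ioo, Prod.mk.injEq] at h1 h2
      obtain ⟨a, ha, h3, h4⟩ := h1
      obtain ⟨b, hb, h5, h6⟩ := h2
      omega
  · intro a _ b _ hab
    change Disjoint (B a) (B b)
    rw [Finset.disjoint_left]
    rintro ⟨x, y⟩ h1 h2
    rw [hmem] at h1 h2
    simp only at h1 h2
    omega

lemma exists_md (l : YPartition) (hl : l.SelfConj) :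
    ∃ M : Finset ℕ, (∀ d, d ∈ M ↔ d ∈ l.MD) ∧ l.size = ∑ d ∈ M, d := by
  classical
  obtain ⟨D, hD⟩ := exists_durfee l
  refine ⟨(Finset.range D).image (fun i => l.hook i i), ?_, ?_⟩
  · intro d
    simp only [Finset.mem_image, Finset.mem_range, YPartition.MD, Set.mem_ofPred_eq]
    constructor
    · rintro ⟨i, h1, h2⟩; exact ⟨i, (hD i).1 h1, h2.symm⟩
    · rintro ⟨i, h1, h2⟩; exact ⟨i, (hD i).2 h1, h2.symm⟩
  · rw [Finset.sum_image, size_eq l hl D hD]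
    intro a ha b hb hab
    have ha' := (hD a).1 (by simpa using ha)
    have hb' := (hD b).1 (by simpa using hb)
    simp only [YPartition.hook] at hab
    rw [hl a, hl b] at hab
    rcases le_total a b with h | h
    · have := l.antitone h; omega
    · have := l.antitone h; omega

open Classical in
lemma size_eq_sum (s t : ℕ) (hs : 0 < s) (ht : 0 < t)
    (hst : Nat.Coprime s t) (l : YPartition) (hl : l.SelfConj)
    (hls : IsCore s l) (hlt : IsCore t l) :
    (l.size : ℤ) = ∑ i ∈ Finset.Icc 1 (s / 2), ∑ j ∈ Finset.Icc 1 (t / 2),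
      if (fmsA s t i j).natAbs ∈ l.MD then |fmsA s t i j| else 0 := by
  obtain ⟨M, hM, hsz⟩ := exists_md l hl
  rw [hsz, ← Finset.sum_product', ← Finset.sum_filter]
  push_cast
  symm
  refine Finset.sum_bij (fun c _ => (fmsA s t c.1 c.2).natAbs) ?_ ?_ ?_ ?_
  · intro c hc
    rw [hM]
    exact (Finset.mem_filter.1 hc).2
  · rintro ⟨i, j⟩ h1 ⟨i', j'⟩ h2 h
    have a1 := Finset.mem_product.1 (Finset.mem_filter.1 h1).1
    have a2 := Finset.mem_product.1 (Finset.mem_filter.1 h2).1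
    have := abs_inj s t hst i j i' j' a1.1 a1.2 a2.1 a2.2 (by
      simp only at h
      rw [Int.abs_eq_natAbs, Int.abs_eq_natAbs, h])
    rw [this.1, this.2]
  · intro d hd
    have hd' := (hM d).1 hd
    obtain ⟨h1, h2⟩ := md_gap s t hs ht l hl hls hlt d hd'
    obtain ⟨i, hi, j, hj, hij⟩ := gap_eq s t ht hst d (by omega) (by omega) h2
    have e : (fmsA s t i j).natAbs = d := by
      rw [Int.abs_eq_natAbs] at hij
      exact_mod_cast hij
    refine ⟨(i, j), ?_, e⟩
    rw [Finset.mem_filter, Finset.mem_product]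
    refine ⟨⟨hi, hj⟩, ?_⟩
    simp only [e]
    exact hd'
  · intro c _
    exact Int.abs_eq_natAbs _

end FMSProof

open YPartition in
open Classical in
/-- Every self-conjugate `(s,t)`-core partition `λ` satisfies
`|λ| = (s²−1)(t²−1)/24 − Σ₁ − Σ₂`, where `Σ₁` is the sum of the positive entries
`A_{i,j}` not in `MD(λ)` and `Σ₂` is the sum of the negative entries `A_{i,j}` whose
absolute value lies in `MD(λ)` (stated multiplied through by `24`). -/
theorem size_selfconjugate_core_formula (s t : ℕ) (hs : 0 < s) (ht : 0 < t)
    (hst : Nat.Coprime s t) (l : YPartition) (hl : l.SelfConj)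
    (hls : IsCore s l) (hlt : IsCore t l) :
    24 * (l.size : ℤ) =
      ((s : ℤ) ^ 2 - 1) * ((t : ℤ) ^ 2 - 1)
      - 24 * (∑ i ∈ Finset.Icc 1 (s / 2), ∑ j ∈ Finset.Icc 1 (t / 2),
          if 0 < fmsA s t i j ∧ (fmsA s t i j).toNat ∉ l.MD then fmsA s t i j else 0)
      - 24 * (∑ i ∈ Finset.Icc 1 (s / 2), ∑ j ∈ Finset.Icc 1 (t / 2),
          if fmsA s t i j < 0 ∧ (-fmsA s t i j).toNat ∈ l.MD then fmsA s t i j else 0) := by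
  have h1 := FMSProof.sum_positive s t hs ht hst
  have h2 := FMSProof.size_eq_sum s t hs ht hst l hl hls hlt
  rw [h2, ← h1, ← mul_sub, ← mul_sub, ← Finset.sum_sub_distrib, ← Finset.sum_sub_distrib]
  congr 1
  refine Finset.sum_congr rfl fun i _ => ?_
  rw [← Finset.sum_sub_distrib, ← Finset.sum_sub_distrib]
  refine Finset.sum_congr rfl fun j _ => ?_
  rcases lt_trichotomy (fmsA s t i j) 0 with h | h | h
  · have e : (-fmsA s t i j).toNat = (fmsA s t i j).natAbs := by omega
    rw [e, abs_of_neg h]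
    simp [h, h.not_gt]
    split_ifs <;> simp
  · simp [h]
  · have e : (fmsA s t i j).toNat = (fmsA s t i j).natAbs := by omega
    rw [e, abs_of_pos h]
    simp [h, h.not_gt]
    split_ifs <;> simp
end

section
/- Let m and n be positive integers. Then Σ_ν Σ_{(i,j)∈ν} i = C(m+2, 3) · C(m+n, m+1), where the outer sum ranges over all partitions ν fitting in the m×n box and the inner sum ranges over all cells (i,j) of the Young diagram of ν (i being the row index). -/
@[ext] theorem YPartition.ext_parts {p q : YPartition} (h : ∀ i, p.parts i = q.parts i) : p = q := by
  cases p; cases q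
  simp only [YPartition.mk.injEq]
  exact funext h

/-- Add a full column of length `m + 1`. -/
def colShift (m : ℕ) (p : YPartition) : YPartition where
  parts i := if i ≤ m then p.parts i + 1 else 0
  antitone := by
    intro i j h
    have := p.antitone h
    split_ifs <;> omega
  finite_support := ⟨m + 1, fun i hi => if_neg (by omega)⟩

/-- The empty partition. -/
def emptyPart : YPartition := ⟨fun _ => 0, fun _ _ _ => le_rfl, 0, fun _ _ => rfl⟩

theorem box_zero_left (n : ℕ) : boxSet 0 n = {emptyPart} := by
  ext p
  simp only [boxSet, Set.mem_ofPred_eq, Set.mem_singleton_iff]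
  constructor
  · rintro ⟨-, h⟩
    apply YPartition.ext_parts
    intro i
    have := p.antitone (Nat.zero_le i)
    simp only [emptyPart]; omega
  · rintro rfl
    simp [emptyPart]

theorem box_zero_right (m : ℕ) : boxSet m 0 = {emptyPart} := by
  ext p
  simp only [boxSet, Set.mem_ofPred_eq, Set.mem_singleton_iff]
  constructor
  · rintro ⟨h, -⟩
    apply YPartition.ext_parts
    intro i
    have := p.antitone (Nat.zero_le i)
    simp only [emptyPart]; omega
  · rintro rfl
    simp [emptyPart]

theorem box_succ (m n : ℕ) :
    boxSet (m + 1) (n + 1) = boxSet m (n + 1) ∪ colShift m '' boxSet (m + 1) n := by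
  ext p
  simp only [boxSet, Set.mem_ofPred_eq, Set.mem_union, Set.mem_image]
  constructor
  · rintro ⟨h0, h1⟩
    by_cases h : p.parts m = 0
    · exact Or.inl ⟨h0, h⟩
    · right
      refine ⟨⟨fun i => p.parts i - 1, ?_, m + 1, ?_⟩, ⟨?_, ?_⟩, ?_⟩
      · intro i j hij
        have := p.antitone hij
        omega
      · intro i hi
        have := p.antitone hi
        omega
      · dsimp only; omega
      · dsimp only; omega
      · apply YPartition.ext_parts
        intro i
        simp only [colShift]
        split_ifs with hi
        · have := p.antitone hi
          omega
        · have := p.antitone (show m + 1 ≤ i by omega)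
          omega
  · rintro (⟨h0, h1⟩ | ⟨q, ⟨h0, h1⟩, rfl⟩)
    · have := p.antitone (Nat.le_succ m)
      exact ⟨h0, by rw [Nat.succ_eq_add_one] at this; omega⟩
    · simp [colShift, h0]

theorem box_disj (m n : ℕ) :
    Disjoint (boxSet m (n + 1)) (colShift m '' boxSet (m + 1) n) := by
  rw [Set.disjoint_left]
  rintro _ ⟨-, h⟩ ⟨q, -, rfl⟩
  simp [colShift] at h

theorem colShift_inj (m n : ℕ) : Set.InjOn (colShift m) (boxSet (m + 1) n) := by
  intro p hp q hq h
  apply YPartition.ext_parts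
  intro i
  have h2 := congrArg (fun r => r.parts i) h
  simp only [colShift] at h2
  split_ifs at h2 with hi
  · omega
  · have := p.antitone (show m + 1 ≤ i by omega)
    have := q.antitone (show m + 1 ≤ i by omega)
    have := hp.2
    have := hq.2
    omega

theorem box_finite (m n : ℕ) : (boxSet m n).Finite := by
  induction m generalizing n with
  | zero => rw [box_zero_left]; exact Set.finite_singleton _
  | succ m ihm =>
    induction n with
    | zero => rw [box_zero_right]; exact Set.finite_singleton _
    | succ n ihn => rw [box_succ]; exact (ihm _).union (ihn.image _)

theorem box_sum (m n : ℕ) (g : YPartition → ℕ) :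
    ∑ᶠ ν ∈ boxSet (m + 1) (n + 1), g ν =
      (∑ᶠ ν ∈ boxSet m (n + 1), g ν) + ∑ᶠ ν ∈ boxSet (m + 1) n, g (colShift m ν) := by
  rw [box_succ, finsum_mem_union (box_disj m n) (box_finite _ _) ((box_finite _ _).image _),
    finsum_mem_image (colShift_inj m n)]

theorem box_count (m n : ℕ) : ∑ᶠ ν ∈ boxSet m n, 1 = Nat.choose (m + n) m := by
  induction m generalizing n with
  | zero => rw [box_zero_left, finsum_mem_singleton]; simp
  | succ m ihm =>
    induction n with
    | zero => rw [box_zero_right, finsum_mem_singleton]; simp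
    | succ n ihn =>
      rw [box_sum m n (fun _ => 1), ihm, ihn, show m + 1 + (n + 1) = (m + (n + 1)) + 1 by ring,
        Nat.choose_succ_succ, show m + 1 + n = m + (n + 1) by ring]

/-- The weight `Σ i ν_i`. -/
def rowWeight (m : ℕ) (p : YPartition) : ℕ := ∑ i ∈ Finset.range m, (i + 1) * p.parts i

theorem rowWeight_shift (m : ℕ) (p : YPartition) :
    rowWeight (m + 1) (colShift m p) = rowWeight (m + 1) p + Nat.choose (m + 2) 2 * 1 := by
  have h1 : ∑ i ∈ Finset.range (m + 1), (i + 1) = Nat.choose (m + 2) 2 := by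
    induction m with
    | zero => rfl
    | succ k ih =>
      rw [Finset.sum_range_succ, ih, Nat.choose_succ_succ (k + 2) 1, Nat.choose_one_right]
      ring
  rw [mul_one, ← h1, rowWeight, rowWeight, ← Finset.sum_add_distrib]
  refine Finset.sum_congr rfl fun i hi => ?_
  have hi' : i ≤ m := by simpa [Nat.lt_succ_iff] using hi
  simp only [colShift, if_pos hi']
  ring

theorem box_weight (m n : ℕ) : ∑ᶠ ν ∈ boxSet m n, rowWeight m ν =
    Nat.choose (m + 2) 3 * Nat.choose (m + n) (m + 1) := by
  induction m generalizing n with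
  | zero => rw [box_zero_left, finsum_mem_singleton]; simp [rowWeight]
  | succ m ihm =>
    induction n with
    | zero => rw [box_zero_right, finsum_mem_singleton]; simp [rowWeight, emptyPart]
    | succ n ihn =>
      have e : ∑ᶠ ν ∈ boxSet m (n + 1), rowWeight (m + 1) ν
          = ∑ᶠ ν ∈ boxSet m (n + 1), rowWeight m ν := by
        refine finsum_mem_congr rfl fun p hp => ?_
        rw [rowWeight, Finset.sum_range_succ, hp.2, mul_zero, add_zero, rowWeight]
      rw [box_sum, e, ihm]
      simp only [rowWeight_shift]
      rw [finsum_mem_add_distrib (box_finite _ _), ihn, ← mul_finsum_mem (fun _ => 1) _,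
        box_count, show m + 1 + (n + 1) = (m + 1 + n) + 1 by ring,
        Nat.choose_succ_succ (m + 1 + n) (m + 1), show m + (n + 1) = m + 1 + n by ring,
        show m + 1 + 2 = (m + 2) + 1 by ring, Nat.choose_succ_succ (m + 2) 2]
      simp only [Nat.succ_eq_add_one]
      ring

open YPartition in
/-- `Σ_ν Σ_{(i,j)∈ν} i = C(m+2,3) · C(m+n, m+1)`, the outer sum over partitions `ν`
fitting in the `m × n` box and the inner sum over (1-indexed) cells `(i,j)` of `ν`. -/
theorem sum_row_indices_box (m n : ℕ) (hm : 0 < m) (hn : 0 < n) :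
    (boxSet m n).Finite ∧
    (∑ᶠ ν ∈ boxSet m n, ∑ i ∈ Finset.Icc 1 m, ∑ _j ∈ Finset.Icc 1 (ν.parts (i - 1)), i)
      = Nat.choose (m + 2) 3 * Nat.choose (m + n) (m + 1) := by
  refine ⟨box_finite m n, ?_⟩
  rw [← box_weight]
  refine finsum_mem_congr rfl fun p _ => ?_
  have h := Finset.sum_Ico_add' (fun i => i * p.parts (i - 1)) 0 m 1
  simp only [Nat.add_sub_cancel, zero_add] at h
  rw [rowWeight, Finset.range_eq_Ico, h]
  refine Finset.sum_congr (by ext; simp) fun i _ => ?_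
  simp [mul_comm]
end

section
/- Let m and n be positive integers. Then Σ_ν Σ_{(i,j)∈ν} j = C(n+2, 3) · C(m+n, n+1), where the outer sum ranges over all partitions ν fitting in the m×n box and the inner sum ranges over all cells (i,j) of the Young diagram of ν (j being the column index). -/
namespace YPartition

theorem ext_parts_s14 {p q : YPartition} (h : ∀ i, p.parts i = q.parts i) : p = q := by
  cases p; cases q
  simp only [mk.injEq]
  exact funext h

/-- Prepend a part `max k (ν.parts 0)`. -/
def consPart (k : ℕ) (ν : YPartition) : YPartition where
  parts i := match i with
    | 0 => max k (ν.parts 0)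
    | i + 1 => ν.parts i
  antitone := by
    intro i j h
    match i, j with
    | 0, 0 => exact le_rfl
    | 0, j + 1 => exact (ν.antitone (Nat.zero_le j)).trans (le_max_right _ _)
    | i + 1, 0 => omega
    | i + 1, j + 1 => exact ν.antitone (by omega)
  finite_support := by
    obtain ⟨N, hN⟩ := ν.finite_support
    refine ⟨N + 1, fun i hi => ?_⟩
    match i with
    | 0 => omega
    | i + 1 => exact hN i (by omega)

theorem consPart_injective (k : ℕ) : Function.Injective (consPart k) := by
  intro p q h
  apply ext_parts_s14
  intro i
  exact congrArg (fun r : YPartition => r.parts (i + 1)) h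

/-- Drop the first part. -/
def tailPart (ν : YPartition) : YPartition where
  parts i := ν.parts (i + 1)
  antitone := fun i j h => ν.antitone (by omega)
  finite_support := by
    obtain ⟨N, hN⟩ := ν.finite_support
    exact ⟨N, fun i hi => hN _ (by omega)⟩

/-- The empty partition. -/
def emptyPart : YPartition where
  parts _ := 0
  antitone := fun _ _ _ => le_rfl
  finite_support := ⟨0, fun _ _ => rfl⟩

/-- The sum of column indices. -/
def colSum (m : ℕ) (ν : YPartition) : ℕ := ∑ i ∈ Finset.range m, (ν.parts i + 1).choose 2

theorem sum_Icc_id (k : ℕ) : ∑ j ∈ Finset.Icc 1 k, j = (k + 1).choose 2 := by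
  induction k with
  | zero => simp
  | succ k ih =>
    rw [Finset.sum_Icc_succ_top (by omega), ih, Nat.choose_succ_succ' (k + 1) 1]
    simp [add_comm]

theorem colSum_eq (m : ℕ) (ν : YPartition) :
    ∑ i ∈ Finset.Icc 1 m, ∑ j ∈ Finset.Icc 1 (ν.parts (i - 1)), j = colSum m ν := by
  simp only [sum_Icc_id]
  induction m with
  | zero => simp [colSum]
  | succ m ih =>
    rw [Finset.sum_Icc_succ_top (by omega), ih, colSum, colSum, Finset.sum_range_succ]
    simp

theorem boxSet_base (m n : ℕ) (h : m = 0 ∨ n = 0) : boxSet m n = {emptyPart} := by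
  ext ν
  simp only [boxSet, Set.mem_ofPred_eq, Set.mem_singleton_iff]
  constructor
  · rintro ⟨h0, h1⟩
    apply ext_parts_s14
    intro i
    have := ν.antitone (Nat.zero_le i)
    rcases h with rfl | rfl
    · exact Nat.le_zero.mp (h1 ▸ this)
    · exact Nat.le_zero.mp (this.trans h0)
  · rintro rfl
    simp [emptyPart]

theorem boxSet_succ (m n : ℕ) :
    boxSet (m + 1) (n + 1) = boxSet (m + 1) n ∪ consPart (n + 1) '' boxSet m (n + 1) := by
  ext ν
  simp only [boxSet, Set.mem_ofPred_eq, Set.mem_union, Set.mem_image]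
  constructor
  · rintro ⟨h0, h1⟩
    by_cases h : ν.parts 0 ≤ n
    · exact Or.inl ⟨h, h1⟩
    · have h2 : ν.parts (0 + 1) ≤ ν.parts 0 := ν.antitone (by omega)
      refine Or.inr ⟨tailPart ν, ⟨?_, h1⟩, ?_⟩
      · simp only [tailPart]; omega
      · apply ext_parts_s14
        intro i
        match i with
        | 0 => simp only [consPart, tailPart]; omega
        | i + 1 => rfl
  · rintro (⟨h0, h1⟩ | ⟨μ, ⟨h0, h1⟩, rfl⟩)
    · exact ⟨by omega, h1⟩
    · exact ⟨by simp only [consPart]; omega, h1⟩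

theorem colSum_cons (m n : ℕ) (ν : YPartition) (h : ν ∈ boxSet m n) :
    colSum (m + 1) (consPart n ν) = colSum m ν + (n + 1).choose 2 := by
  rw [colSum, Finset.sum_range_succ', colSum]
  have : max n (ν.parts 0) = n := max_eq_left h.1
  simp only [consPart, this]

theorem box_main (m n : ℕ) : ∃ F : Finset YPartition, (F : Set YPartition) = boxSet m n ∧
    F.card = (m + n).choose n ∧
    ∑ ν ∈ F, colSum m ν = (n + 2).choose 3 * (m + n).choose (n + 1) := by
  classical
  induction m generalizing n with
  | zero =>
    refine ⟨{emptyPart}, ?_, ?_, ?_⟩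
    · rw [boxSet_base _ _ (Or.inl rfl)]; simp
    · simp
    · simp [colSum]
  | succ m ihm =>
    induction n with
    | zero =>
      refine ⟨{emptyPart}, ?_, ?_, ?_⟩
      · rw [boxSet_base _ _ (Or.inr rfl)]; simp
      · simp
      · simp [colSum, emptyPart]
    | succ n ihn =>
      obtain ⟨F, hF, hFc, hFs⟩ := ihn
      obtain ⟨G, hG, hGc, hGs⟩ := ihm (n + 1)
      have hd : Disjoint F (G.image (consPart (n + 1))) := by
        rw [Finset.disjoint_left]
        intro ν h1 h2
        obtain ⟨μ, -, rfl⟩ := Finset.mem_image.mp h2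
        have h3 : consPart (n + 1) μ ∈ boxSet (m + 1) n := hF ▸ h1
        have h4 := h3.1
        simp only [consPart] at h4
        omega
      have e1 : m + 1 + (n + 1) = (m + n + 1) + 1 := by omega
      have e2 : m + 1 + n = m + n + 1 := by omega
      have e3 : m + (n + 1) = m + n + 1 := by omega
      rw [e2] at hFc hFs
      rw [e3] at hGc hGs
      refine ⟨F ∪ G.image (consPart (n + 1)), ?_, ?_, ?_⟩
      · rw [boxSet_succ, Finset.coe_union, Finset.coe_image, hF, hG]
      · rw [Finset.card_union_of_disjoint hd, Finset.card_image_of_injective _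
          (consPart_injective _), hFc, hGc, e1, Nat.choose_succ_succ' (m + n + 1) n]
      · rw [Finset.sum_union hd, Finset.sum_image (fun a _ b _ h => consPart_injective _ h),
          hFs, Finset.sum_congr rfl (fun ν hν => colSum_cons m (n + 1) ν (hG ▸ hν)),
          Finset.sum_add_distrib, hGs, Finset.sum_const, hGc, e1,
          Nat.choose_succ_succ' (m + n + 1) (n + 1), show n + 1 + 2 = (n + 2) + 1 by omega,
          Nat.choose_succ_succ' (n + 2) 2, smul_eq_mul]
        ring

end YPartition

open YPartition in
/-- `Σ_ν Σ_{(i,j)∈ν} j = C(n+2,3) · C(m+n, n+1)`, the outer sum over partitions `ν`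
fitting in the `m × n` box and the inner sum over (1-indexed) cells `(i,j)` of `ν`. -/
theorem sum_col_indices_box (m n : ℕ) (hm : 0 < m) (hn : 0 < n) :
    (boxSet m n).Finite ∧
    (∑ᶠ ν ∈ boxSet m n, ∑ i ∈ Finset.Icc 1 m, ∑ j ∈ Finset.Icc 1 (ν.parts (i - 1)), j)
      = Nat.choose (n + 2) 3 * Nat.choose (m + n) (n + 1) := by
  obtain ⟨F, hF, -, hs⟩ := box_main m n
  rw [← hF]
  refine ⟨F.finite_toSet, ?_⟩
  simp only [colSum_eq]
  rw [← hs]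
  exact finsum_mem_coe_finset _ F
end
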